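/- arXiv:1912.06043 — 2 statements merged into one kernel-verified Lean document; each statement's English description precedes it below -/
import Mathlib

section
/- Let F be a finite field with q elements where q ≥ 16 is even. Then every generalized k-arc in P²(F) satisfies k ≤ q − (√q)/2 + 17/4. -/
/-- The projective plane over `F`: points are 1-dimensional subspaces of `F³`. -/
abbrev P2 (F : Type*) [Field F] := Projectivization F (Fin 3 → F)

/-- A conic in `P²(F)`: the vanishing set of a nonzero homogeneous quadratic form
in three variables (possibly reducible). -/
def IsConic {F : Type*} [Field F] (C : Set (P2 F)) : Prop :=
  ∃ Q : MvPolynomial (Fin 3) F, Q ≠ 0 ∧ Q.IsHomogeneous 2 ∧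
    C = {p : P2 F | MvPolynomial.eval p.rep Q = 0}

/-- A line in `P²(F)`: the vanishing set of a nonzero linear form in three variables. -/
def IsLine {F : Type*} [Field F] (L : Set (P2 F)) : Prop :=
  ∃ φ : MvPolynomial (Fin 3) F, φ ≠ 0 ∧ φ.IsHomogeneous 1 ∧
    L = {p : P2 F | MvPolynomial.eval p.rep φ = 0}

/-- A generalized arc: no conic contains 6 of its points. -/
def IsGenArc {F : Type*} [Field F] (K : Set (P2 F)) : Prop :=
  ∀ C : Set (P2 F), IsConic C → (K ∩ C).ncard ≤ 5

/-- An arc: no line contains 3 of its points. -/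
def IsArc {F : Type*} [Field F] (K : Set (P2 F)) : Prop :=
  ∀ L : Set (P2 F), IsLine L → (K ∩ L).ncard ≤ 2

section Interpolation

variable {F : Type*} [Field F]

/-- The determinant of three vectors of `F³`. -/
def bracket (x y z : F × F × F) : F :=
  x.1 * (y.2.1 * z.2.2 - y.2.2 * z.2.1) - x.2.1 * (y.1 * z.2.2 - y.2.2 * z.1) +
    x.2.2 * (y.1 * z.2.1 - y.2.1 * z.1)

/-- The value at `y` of the linear form with coefficient vector `l`. -/
def linForm (l y : F × F × F) : F := l.1 * y.1 + l.2.1 * y.2.1 + l.2.2 * y.2.2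

/-- `h` is a constant multiple of a product of `n` linear forms that vanish at `x`. -/
def IsFormProd (x : F × F × F) (n : ℕ) (h : F × F × F → F) : Prop :=
  ∃ (a : F) (L : Multiset (F × F × F)), L.card = n ∧ (∀ l ∈ L, linForm l x = 0) ∧
    ∀ y, h y = a * (L.map fun l => linForm l y).prod

lemma linForm_mul_bracket {l x : F × F × F} (hl : linForm l x = 0) (y z w : F × F × F) :
    linForm l y * bracket x z w = linForm l z * bracket x y w + linForm l w * bracket x z y := by
  simp only [linForm, bracket] at *
  linear_combination (-(y.1 * (z.2.1 * w.2.2 - z.2.2 * w.2.1) -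
    y.2.1 * (z.1 * w.2.2 - z.2.2 * w.1) + y.2.2 * (z.1 * w.2.1 - z.2.1 * w.1))) * -hl

lemma bracket_self_right (x y : F × F × F) : bracket x y y = 0 := by
  simp only [bracket]; ring

variable [CharP F 2]

lemma bracket_swap_left (x y z : F × F × F) : bracket x y z = bracket y x z := by
  rw [← CharTwo.neg_eq (bracket y x z)]; simp only [bracket]; ring

lemma bracket_swap_right (x y z : F × F × F) : bracket x y z = bracket x z y := by
  rw [← CharTwo.neg_eq (bracket x z y)]; simp only [bracket]; ring

open Classical in
/-- The divided differences of a product of linear forms on a pencil of lines vanish when there are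
enough nodes. -/
lemma sum_prod_linForm_eq_zero (x : F × F × F) (L : Multiset (F × F × F)) :
    (∀ l ∈ L, linForm l x = 0) → ∀ N : Finset (F × F × F),
      (∀ z ∈ N, ∀ w ∈ N, z ≠ w → bracket x z w ≠ 0) → N.card = L.card + 2 →
      ∑ z ∈ N, (L.map fun l => linForm l z).prod * (∏ w ∈ N.erase z, bracket x w z)⁻¹ = 0 := by
  induction L using Multiset.induction with
  | empty =>
    intro _ N hN hc
    obtain ⟨z, w, hzw, rfl⟩ := Finset.card_eq_two.mp (by simpa using hc)
    rw [Finset.sum_pair hzw]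
    have e1 : ({z, w} : Finset (F × F × F)).erase z = {w} := by grind
    have e2 : ({z, w} : Finset (F × F × F)).erase w = {z} := by grind
    rw [e1, e2]
    simp [bracket_swap_right x w z, CharTwo.add_self_eq_zero]
  | cons l L ih =>
    intro hL N hN hc
    have hl := hL l (by simp)
    have ih' := ih fun m hm => hL m (by simp [hm])
    rw [Multiset.card_cons] at hc
    obtain ⟨z₁, h₁, z₂, h₂, hne⟩ := Finset.one_lt_card.mp (show 1 < N.card by omega)
    have key : ∀ v ∈ N, ∑ z ∈ N, (L.map fun l => linForm l z).prod * bracket x v z *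
        (∏ w ∈ N.erase z, bracket x w z)⁻¹ = 0 := by
      intro v hv
      rw [← ih' (N.erase v) (fun z hz w hw => hN z (Finset.mem_of_mem_erase hz) w
        (Finset.mem_of_mem_erase hw)) (by rw [Finset.card_erase_of_mem hv]; omega),
        ← Finset.add_sum_erase N _ hv, bracket_self_right]
      simp only [mul_zero, zero_mul, zero_add]
      refine Finset.sum_congr rfl fun z hz => ?_
      have hzv := Finset.ne_of_mem_erase hz
      have hb := hN v hv z (Finset.mem_of_mem_erase hz) hzv.symm
      rw [← Finset.mul_prod_erase (N.erase z) _ (Finset.mem_erase.mpr ⟨hzv.symm, hv⟩),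
        Finset.erase_right_comm, mul_inv, mul_assoc, mul_inv_cancel_left₀ hb]
    refine (mul_eq_zero.mp ?_).resolve_left (hN z₁ h₁ z₂ h₂ hne)
    have : bracket x z₁ z₂ * ∑ z ∈ N, ((l ::ₘ L).map fun l => linForm l z).prod *
        (∏ w ∈ N.erase z, bracket x w z)⁻¹ =
        linForm l z₁ * (∑ z ∈ N, (L.map fun l => linForm l z).prod * bracket x z₂ z *
          (∏ w ∈ N.erase z, bracket x w z)⁻¹) +
        linForm l z₂ * ∑ z ∈ N, (L.map fun l => linForm l z).prod * bracket x z₁ z *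
          (∏ w ∈ N.erase z, bracket x w z)⁻¹ := by
      rw [Finset.mul_sum, Finset.mul_sum, Finset.mul_sum, ← Finset.sum_add_distrib]
      refine Finset.sum_congr rfl fun z _ => ?_
      rw [Multiset.map_cons, Multiset.prod_cons, bracket_swap_right x z₂ z]
      linear_combination (L.map fun l => linForm l z).prod * (∏ w ∈ N.erase z, bracket x w z)⁻¹ *
        linForm_mul_bracket hl z z₁ z₂
    rw [this, key z₂ h₂, key z₁ h₁]; ring

open Classical in
lemma IsFormProd.sum_eq_zero {x : F × F × F} {n : ℕ} {h : F × F × F → F} (hh : IsFormProd x n h)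
    {N : Finset (F × F × F)} (hN : ∀ z ∈ N, ∀ w ∈ N, z ≠ w → bracket x z w ≠ 0)
    (hc : N.card = n + 2) : ∑ z ∈ N, h z * (∏ w ∈ N.erase z, bracket x w z)⁻¹ = 0 := by
  obtain ⟨a, L, rfl, hL, hy⟩ := hh
  simp only [hy, mul_assoc, ← Finset.mul_sum, sum_prod_linForm_eq_zero x L hL N hN hc, mul_zero]

/-- In characteristic two, a symmetric off-diagonal double sum vanishes. -/
lemma sum_sum_erase_eq_zero {α : Type*} [DecidableEq α] (s : Finset α) (f : α → α → F)
    (hf : ∀ x ∈ s, ∀ y ∈ s, x ≠ y → f x y = f y x) : ∑ x ∈ s, ∑ y ∈ s.erase x, f x y = 0 := by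
  rw [Finset.sum_sigma']
  refine Finset.sum_involution (fun p _ => ⟨p.2, p.1⟩) ?_ ?_ ?_ ?_
  · rintro ⟨x, y⟩ h
    simp only [Finset.mem_sigma, Finset.mem_erase] at h
    rw [hf x h.1 y h.2.2 h.2.1.symm, CharTwo.add_self_eq_zero]
  · rintro ⟨x, y⟩ h _ e
    simp only [Finset.mem_sigma, Finset.mem_erase] at h
    simp only [Sigma.mk.injEq, heq_eq_eq] at e
    exact h.2.1 e.1
  · rintro ⟨x, y⟩ h
    simp only [Finset.mem_sigma, Finset.mem_erase] at h ⊢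
    exact ⟨h.2.2, h.2.1.symm, h.1⟩
  · rintro ⟨x, y⟩ _
    rfl

open Classical in
/-- Segre's envelope argument: if the tangents at `n + 2` points of an arc pass through `P`, then
the product of the tangents at any other point vanishes at `P`. -/
lemma tangent_prod_eq_zero {K Z : Finset (F × F × F)} {h : F × F × F → F × F × F → F} {n : ℕ}
    {P y : F × F × F}
    (harc : ∀ x ∈ K, ∀ y ∈ K, ∀ z ∈ K, x ≠ y → x ≠ z → y ≠ z → bracket x y z ≠ 0)
    (hsymm : ∀ x ∈ K, ∀ y ∈ K, x ≠ y → h x y = h y x)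
    (hZK : Z ⊆ K) (hZ : Z.card = n + 2) (hy : y ∈ K) (hyZ : y ∉ Z)
    (hform : IsFormProd y (n + 1) (h y))
    (hP : ∀ z ∈ Z, ∃ h', IsFormProd z n h' ∧ ∀ w, h z w = bracket z P w * h' w)
    (hPne : ∀ z ∈ Z, ∀ w ∈ K, z ≠ w → bracket z P w ≠ 0) : h y P = 0 := by
  choose! h' hh' hfac using hP
  have hne : ∀ z ∈ Z, z ≠ y := fun z hz e => hyZ (e ▸ hz)
  have hPZ : P ∉ Z := by
    intro hPZ
    exact hPne P hPZ y hy (hne P hPZ) (by simp only [bracket]; ring)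
  have hsymm' : ∀ z ∈ Z, ∀ w ∈ Z, z ≠ w → h' z w = h' w z := by
    intro z hz w hw hzw
    have h1 := hfac z hz w
    rw [hsymm z (hZK hz) w (hZK hw) hzw, hfac w hw z, bracket_swap_left, bracket_swap_right P,
      ← bracket_swap_left z P w] at h1
    exact (mul_left_cancel₀ (hPne z hz w (hZK hw) hzw) h1).symm
  have hnodes : ∀ z ∈ Z, ∑ w ∈ Z.erase z,
      h' z w * (bracket z y w * ∏ v ∈ (Z.erase z).erase w, bracket z v w)⁻¹ =
      h' z y * (∏ v ∈ Z.erase z, bracket z v y)⁻¹ := by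
    intro z hz
    have hyz : y ∉ Z.erase z := fun e => hyZ (Finset.mem_of_mem_erase e)
    have h1 := (hh' z hz).sum_eq_zero (N := insert y (Z.erase z)) (by
      intro a ha b hb hab
      have hzK : ∀ a ∈ insert y (Z.erase z), a ∈ K ∧ z ≠ a := by
        intro a ha
        rcases Finset.mem_insert.mp ha with rfl | ha
        · exact ⟨hy, hne z hz⟩
        · exact ⟨hZK (Finset.mem_of_mem_erase ha), (Finset.ne_of_mem_erase ha).symm⟩
      exact harc z (hZK hz) a (hzK a ha).1 b (hzK b hb).1 (hzK a ha).2 (hzK b hb).2 hab)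
      (by rw [Finset.card_insert_of_notMem hyz, Finset.card_erase_of_mem hz]; omega)
    rw [Finset.sum_insert hyz, Finset.erase_insert hyz, CharTwo.add_eq_zero] at h1
    rw [h1]
    refine Finset.sum_congr rfl fun w hw => ?_
    rw [Finset.erase_insert_of_ne (show y ≠ w by rintro rfl; exact hyz hw), Finset.prod_insert]
    exact fun e => hyz (Finset.mem_of_mem_erase e)
  have hsum : ∑ z ∈ Z, h' z y * (∏ v ∈ Z.erase z, bracket z v y)⁻¹ = 0 := by
    rw [← Finset.sum_congr rfl hnodes]
    refine sum_sum_erase_eq_zero Z _ fun z hz w hw hzw => ?_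
    rw [hsymm' z hz w hw hzw, bracket_swap_left z y w, bracket_swap_right y, bracket_swap_left y w z,
      Finset.erase_right_comm]
    congr 3
    refine Finset.prod_congr rfl fun v _ => ?_
    rw [bracket_swap_left, bracket_swap_right, bracket_swap_left]
  have hy2 := hform.sum_eq_zero (N := insert P Z) (by
    intro a ha b hb hab
    rcases Finset.mem_insert.mp ha with ha' | ha' <;> rcases Finset.mem_insert.mp hb with hb' | hb'
    · exact absurd (ha'.trans hb'.symm) hab
    · rw [ha', bracket_swap_right, bracket_swap_left, bracket_swap_right]
      exact hPne b hb' y hy (hne b hb')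
    · rw [hb', bracket_swap_left, bracket_swap_right]
      exact hPne a ha' y hy (hne a ha')
    · exact harc y hy a (hZK ha') b (hZK hb') (hne a ha').symm (hne b hb').symm hab)
    (by rw [Finset.card_insert_of_notMem hPZ]; omega)
  rw [Finset.sum_insert hPZ, Finset.erase_insert hPZ] at hy2
  have : ∑ z ∈ Z, h y z * (∏ w ∈ (insert P Z).erase z, bracket y w z)⁻¹ = 0 := by
    rw [← hsum]
    refine Finset.sum_congr rfl fun z hz => ?_
    rw [Finset.erase_insert_of_ne (show P ≠ z by rintro rfl; exact hPZ hz),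
      Finset.prod_insert (fun e => hPZ (Finset.mem_of_mem_erase e)),
      hsymm y hy z (hZK hz) (hne z hz).symm, hfac z hz y, bracket_swap_right y P z,
      bracket_swap_left y z P, bracket_swap_right z y P, mul_inv]
    have : ∏ v ∈ Z.erase z, bracket y v z = ∏ v ∈ Z.erase z, bracket z v y :=
      Finset.prod_congr rfl fun v _ => by
        rw [bracket_swap_right, bracket_swap_left, bracket_swap_right]
    rw [this]
    field_simp [hPne z hz y hy (hne z hz)]
  rw [this, add_zero] at hy2
  refine (mul_eq_zero.mp hy2).resolve_right (inv_ne_zero (Finset.prod_ne_zero_iff.mpr ?_))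
  intro z hz
  rw [bracket_swap_left, bracket_swap_right]
  exact hPne z hz y hy (hne z hz)

end Interpolation

section AffineArc

variable {F : Type*} [Field F]

/-- The determinant measuring collinearity of three points of the affine plane. -/
def det3 (p q r : F × F) : F := (q.1 - p.1) * (r.2 - p.2) - (r.1 - p.1) * (q.2 - p.2)

/-- A set of affine points that is an arc together with the two points at infinity of the
coordinate axes. -/
structure IsAffArc (S : Finset (F × F)) : Prop where
  fst_ne : ∀ p ∈ S, ∀ q ∈ S, p ≠ q → p.1 ≠ q.1
  snd_ne : ∀ p ∈ S, ∀ q ∈ S, p ≠ q → p.2 ≠ q.2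
  det3_ne : ∀ p ∈ S, ∀ q ∈ S, ∀ r ∈ S, p ≠ q → p ≠ r → q ≠ r → det3 p q r ≠ 0

/-- The graph of `f` together with the two points at infinity of the axes is a hyperoval. -/
structure IsOvalFun (f : F → F) : Prop where
  inj : Function.Injective f
  det3_ne : ∀ x y z, x ≠ y → x ≠ z → y ≠ z → det3 (x, f x) (y, f y) (z, f z) ≠ 0

lemma isFormProd_prod {ι : Type*} (x : F × F × F) (s : Finset ι) (a : F) (l : ι → F × F × F)
    (hl : ∀ i ∈ s, linForm (l i) x = 0) :
    IsFormProd x s.card fun y => a * ∏ i ∈ s, linForm (l i) y :=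
  ⟨a, s.val.map l, by simp, by simpa using hl, fun y => by rw [Multiset.map_map]; rfl⟩

open Classical in
lemma prod_erase_zero_eq_neg_one [Fintype F] : ∏ u ∈ (Finset.univ : Finset F).erase 0, u = -1 := by
  have h := congrArg (fun u : Fˣ => (u : F)) (FiniteField.prod_univ_units_id_eq_neg_one (K := F))
  simp only [Units.coe_prod, Units.val_neg, Units.val_one] at h
  rw [← h]
  refine (Finset.prod_bij (fun (u : Fˣ) _ => (u : F)) ?_ ?_ ?_ ?_).symm
  · intro u _; simp
  · intro u _ v _ h; exact Units.ext h
  · intro b hb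
    exact ⟨Units.mk0 b (by simpa using hb), by simp, rfl⟩
  · intro u _; rfl

open Classical in
lemma prod_erase_sub_mul_eq_one [Fintype F] [CharP F 2] {a b s : F} (ha : a ≠ 0) (hs : b = s * a) :
    ∏ m ∈ (Finset.univ : Finset F).erase s, (b - m * a) = 1 := by
  rw [← CharTwo.neg_eq 1, ← prod_erase_zero_eq_neg_one]
  refine Finset.prod_bij (fun m _ => b - m * a) ?_ ?_ ?_ ?_
  · intro m hm
    simp only [Finset.mem_erase, Finset.mem_univ, and_true, ne_eq] at hm ⊢
    rw [hs, ← sub_mul]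
    exact mul_ne_zero (sub_ne_zero.mpr (Ne.symm hm)) ha
  · intro m _ n _ h
    exact mul_right_cancel₀ ha (sub_right_injective h)
  · intro c hc
    simp only [Finset.mem_erase, Finset.mem_univ, and_true, ne_eq] at hc
    refine ⟨(b - c) / a, ?_, by field_simp; ring⟩
    simp only [Finset.mem_erase, Finset.mem_univ, and_true, ne_eq]
    intro e
    rw [div_eq_iff ha, ← hs] at e
    exact hc (by simpa using e)
  · intros; rfl

open Classical in
/-- The slopes of the tangents to `S` at `c`. -/
noncomputable def tangentSlopes [Fintype F] (S : Finset (F × F)) (c : F × F) : Finset F :=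
  Finset.univ.filter fun m => m ≠ 0 ∧ ∀ d ∈ S, d ≠ c → d.2 - c.2 ≠ m * (d.1 - c.1)

open Classical in
/-- The product of the tangents to `S` at `v`, normalised so as to be symmetric. -/
noncomputable def tangentProd [Fintype F] (S : Finset (F × F)) (v w : F × F × F) : F :=
  if v.1 = 0 then ∏ x ∈ Finset.univ \ S.image Prod.fst, linForm (-x, 1, 0) w
  else (∏ e ∈ S.erase v.2, (e.1 - v.2.1))⁻¹ *
    ∏ m ∈ tangentSlopes S v.2, linForm (m * v.2.1 - v.2.2, -m, 1) w

lemma mem_tangentSlopes [Fintype F] {S : Finset (F × F)} {c : F × F} {m : F} : m ∈ tangentSlopes S c ↔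
    m ≠ 0 ∧ ∀ d ∈ S, d ≠ c → d.2 - c.2 ≠ m * (d.1 - c.1) := by
  simp [tangentSlopes]

open Classical in
lemma IsAffArc.slope_injOn {S : Finset (F × F)} (hS : IsAffArc S) {c : F × F} (hc : c ∈ S) :
    Set.InjOn (fun d : F × F => (d.2 - c.2) / (d.1 - c.1)) (S.erase c) := by
  intro d hd e he h
  simp only [Finset.coe_erase, Set.mem_sdiff, Finset.mem_coe, Set.mem_singleton_iff] at hd he
  by_contra hne
  refine hS.det3_ne c hc d hd.1 e he.1 (Ne.symm hd.2) (Ne.symm he.2) hne ?_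
  have h1 := sub_ne_zero.mpr (hS.fst_ne d hd.1 c hc hd.2)
  have h2 := sub_ne_zero.mpr (hS.fst_ne e he.1 c hc he.2)
  simp only at h
  rw [div_eq_div_iff h1 h2] at h
  simp only [det3]
  linear_combination -h

open Classical in
lemma IsAffArc.compl_tangentSlopes [Fintype F] {S : Finset (F × F)} (hS : IsAffArc S) {c : F × F}
    (hc : c ∈ S) : (Finset.univ : Finset F) \ tangentSlopes S c =
      insert 0 ((S.erase c).image fun d : F × F => (d.2 - c.2) / (d.1 - c.1)) := by
  ext m
  simp only [Finset.mem_sdiff, Finset.mem_univ, true_and, mem_tangentSlopes, Finset.mem_insert,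
    Finset.mem_image, Finset.mem_erase]
  constructor
  · intro h
    by_contra! h'
    refine h ⟨h'.1, fun d hd hdc e => h'.2 d ⟨hdc, hd⟩ ?_⟩
    rw [div_eq_iff (sub_ne_zero.mpr (hS.fst_ne d hd c hc hdc)), e]
  · rintro (h | ⟨d, ⟨hdc, hd⟩, rfl⟩) h'
    · exact h'.1 h
    · exact h'.2 d hd hdc
        (div_mul_cancel₀ _ (sub_ne_zero.mpr (hS.fst_ne d hd c hc hdc))).symm

open Classical in
lemma IsAffArc.zero_notMem_slopes {S : Finset (F × F)} (hS : IsAffArc S) {c : F × F}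
    (hc : c ∈ S) : (0 : F) ∉ (S.erase c).image fun d : F × F => (d.2 - c.2) / (d.1 - c.1) := by
  simp only [Finset.mem_image, Finset.mem_erase, not_exists, not_and, and_imp]
  intro d hdc hd
  exact div_ne_zero (sub_ne_zero.mpr (hS.snd_ne d hd c hc hdc))
    (sub_ne_zero.mpr (hS.fst_ne d hd c hc hdc))

lemma IsAffArc.card_tangentSlopes [Fintype F] {S : Finset (F × F)} (hS : IsAffArc S) {c : F × F}
    (hc : c ∈ S) : (tangentSlopes S c).card + S.card = Fintype.card F := by
  classical
  have h1 := Finset.card_sdiff_add_card_eq_card (Finset.subset_univ (tangentSlopes S c))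
  rw [hS.compl_tangentSlopes hc, Finset.card_insert_of_notMem (hS.zero_notMem_slopes hc),
    Finset.card_image_of_injOn (hS.slope_injOn hc), Finset.card_erase_of_mem hc,
    Finset.card_univ] at h1
  have := Finset.card_pos.mpr ⟨c, hc⟩
  omega

open Classical in
/-- The product of the tangents at `c`, evaluated at another point of the arc. -/
lemma IsAffArc.prod_tangentSlopes_mul [Fintype F] [CharP F 2] {S : Finset (F × F)} (hS : IsAffArc S) {c d : F × F}
    (hc : c ∈ S) (hd : d ∈ S) (hdc : d ≠ c) :
    (∏ m ∈ tangentSlopes S c, (d.2 - c.2 - m * (d.1 - c.1))) *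
      ((d.1 - c.1) * (d.2 - c.2) * ∏ e ∈ (S.erase c).erase d, det3 c d e) =
      ∏ e ∈ S.erase c, (e.1 - c.1) := by
  have h0 := sub_ne_zero.mpr (hS.fst_ne d hd c hc hdc)
  have hd' : d ∈ S.erase c := Finset.mem_erase.mpr ⟨hdc, hd⟩
  set σ : F × F → F := fun d => (d.2 - c.2) / (d.1 - c.1) with hσ
  have key := prod_erase_sub_mul_eq_one h0 (div_mul_cancel₀ (d.2 - c.2) h0).symm
  have hset : (Finset.univ : Finset F).erase (σ d) =
      (tangentSlopes S c) ∪ insert 0 (((S.erase c).erase d).image σ) := by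
    have h1 := hS.compl_tangentSlopes hc
    have h2 := hS.slope_injOn hc
    ext m
    have h3 := congrArg (m ∈ ·) h1
    simp only [Finset.mem_sdiff, Finset.mem_univ, true_and, Finset.mem_insert,
      eq_iff_iff] at h3
    simp only [Finset.mem_erase, Finset.mem_univ, and_true, Finset.mem_union, Finset.mem_insert]
    have h4 : m ∈ ((S.erase c).erase d).image σ ↔ m ∈ (S.erase c).image σ ∧ m ≠ σ d := by
      constructor
      · intro h
        obtain ⟨e, he, rfl⟩ := Finset.mem_image.mp h
        refine ⟨Finset.mem_image_of_mem _ (Finset.mem_of_mem_erase he), fun h => ?_⟩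
        exact Finset.ne_of_mem_erase he (h2 (Finset.mem_of_mem_erase he) hd' h)
      · rintro ⟨h, hne⟩
        obtain ⟨e, he, rfl⟩ := Finset.mem_image.mp h
        refine Finset.mem_image_of_mem _ (Finset.mem_erase.mpr ⟨?_, he⟩)
        rintro rfl; exact hne rfl
    have h5 : m = 0 → m ≠ σ d := by
      rintro rfl h
      exact hS.zero_notMem_slopes hc (h ▸ Finset.mem_image_of_mem σ hd')
    have h6 : m ∈ tangentSlopes S c → m ≠ σ d := by
      intro h e
      exact h3.mpr (Or.inr (e ▸ Finset.mem_image_of_mem σ hd')) h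
    rw [h4]
    tauto
  rw [show (d.2 - c.2) / (d.1 - c.1) = σ d from rfl, hset, Finset.prod_union, Finset.prod_insert,
    Finset.prod_image] at key
  · rw [← Finset.mul_prod_erase (S.erase c) _ hd']
    have h7 : ∏ e ∈ (S.erase c).erase d, det3 c d e = (∏ e ∈ (S.erase c).erase d, (e.1 - c.1)) *
        ∏ e ∈ (S.erase c).erase d, (d.2 - c.2 - σ e * (d.1 - c.1)) := by
      rw [← Finset.prod_mul_distrib]
      refine Finset.prod_congr rfl fun e he => ?_
      have he' := Finset.mem_erase.mp (Finset.mem_of_mem_erase he)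
      have := sub_ne_zero.mpr (hS.fst_ne e he'.2 c hc he'.1)
      rw [← CharTwo.neg_eq (det3 c d e)]
      simp only [hσ, det3]
      field_simp
      ring
    rw [h7]
    rw [zero_mul, sub_zero] at key
    linear_combination (d.1 - c.1) * (∏ e ∈ (S.erase c).erase d, (e.1 - c.1)) * key
  · intro x hx y hy h
    exact hS.slope_injOn hc (Finset.mem_of_mem_erase hx) (Finset.mem_of_mem_erase hy) h
  · intro h
    refine hS.zero_notMem_slopes hc ?_
    exact Finset.image_subset_image (Finset.erase_subset _ _) h
  · rw [Finset.disjoint_left]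
    intro m hm hm'
    have := (congrArg (m ∈ ·) (hS.compl_tangentSlopes hc)).mpr (by
      refine Finset.insert_subset_insert _ ?_ hm'
      exact Finset.image_subset_image (Finset.erase_subset _ _))
    exact (Finset.mem_sdiff.mp this).2 hm

end AffineArc

section AffineArc

variable {F : Type*} [Field F]

lemma bracket_affine (p q r : F × F) : bracket ((1 : F), p) (1, q) (1, r) = det3 p q r := by
  simp only [bracket, det3]; ring

open Classical in
lemma tangentProd_affine [Fintype F] (S : Finset (F × F)) (c : F × F) (w : F × F × F) :
    tangentProd S (1, c) w = (∏ e ∈ S.erase c, (e.1 - c.1))⁻¹ *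
      ∏ m ∈ tangentSlopes S c, linForm (m * c.1 - c.2, -m, 1) w := by
  simp [tangentProd]

open Classical in
lemma IsAffArc.tangentProd_mul [Fintype F] [CharP F 2] {S : Finset (F × F)} (hS : IsAffArc S)
    {c d : F × F} (hc : c ∈ S) (hd : d ∈ S) (hdc : d ≠ c) :
    tangentProd S (1, c) (1, d) *
      ((d.1 - c.1) * (d.2 - c.2) * ∏ e ∈ (S.erase c).erase d, det3 c d e) = 1 := by
  have h := hS.prod_tangentSlopes_mul hc hd hdc
  have hU : ∏ e ∈ S.erase c, (e.1 - c.1) ≠ 0 := by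
    refine Finset.prod_ne_zero_iff.mpr fun e he => sub_ne_zero.mpr ?_
    exact hS.fst_ne e (Finset.mem_of_mem_erase he) c hc (Finset.ne_of_mem_erase he)
  have hform : ∏ m ∈ tangentSlopes S c, linForm (m * c.1 - c.2, -m, 1) ((1 : F), d) =
      ∏ m ∈ tangentSlopes S c, (d.2 - c.2 - m * (d.1 - c.1)) :=
    Finset.prod_congr rfl fun m _ => by simp only [linForm]; ring
  rw [tangentProd_affine, hform, mul_assoc, h, inv_mul_cancel₀ hU]

lemma IsAffArc.tangentProd_comm [Fintype F] [CharP F 2] {S : Finset (F × F)} (hS : IsAffArc S)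
    {c d : F × F} (hc : c ∈ S) (hd : d ∈ S) (hdc : d ≠ c) :
    tangentProd S (1, c) (1, d) = tangentProd S (1, d) (1, c) := by
  classical
  have h1 := hS.tangentProd_mul hc hd hdc
  have h2 := hS.tangentProd_mul hd hc hdc.symm
  have h3 : (c.1 - d.1) * (c.2 - d.2) * ∏ e ∈ (S.erase d).erase c, det3 d c e =
      (d.1 - c.1) * (d.2 - c.2) * ∏ e ∈ (S.erase c).erase d, det3 c d e := by
    rw [Finset.erase_right_comm]
    congr 1
    · ring
    · refine Finset.prod_congr rfl fun e _ => ?_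
      rw [← bracket_affine, bracket_swap_left, bracket_affine]
  rw [h3] at h2
  exact mul_right_cancel₀ (right_ne_zero_of_mul_eq_one h1) (h1.trans h2.symm)

open Classical in
lemma IsAffArc.tangentProd_infinity [Fintype F] [CharP F 2] {S : Finset (F × F)} (hS : IsAffArc S)
    {c : F × F} (hc : c ∈ S) : tangentProd S (0, 0, 1) (1, c) = tangentProd S (1, c) (0, 0, 1) := by
  have hU : ∏ e ∈ S.erase c, (e.1 - c.1) ≠ 0 := by
    refine Finset.prod_ne_zero_iff.mpr fun e he => sub_ne_zero.mpr ?_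
    exact hS.fst_ne e (Finset.mem_of_mem_erase he) c hc (Finset.ne_of_mem_erase he)
  have hinj : Set.InjOn Prod.fst (S : Set (F × F)) := by
    intro p hp r hr h
    by_contra hne
    exact hS.fst_ne p hp r hr hne h
  rw [tangentProd_affine]
  simp only [tangentProd, linForm, if_true, mul_zero, add_zero, zero_add, mul_one,
    Finset.prod_const_one]
  have key := prod_erase_sub_mul_eq_one (F := F) (a := 1) (b := c.1) (s := c.1) one_ne_zero (by simp)
  have hset : (Finset.univ : Finset F).erase c.1 =
      (Finset.univ \ S.image Prod.fst) ∪ (S.erase c).image Prod.fst := by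
    ext x
    simp only [Finset.mem_erase, Finset.mem_univ, and_true, Finset.mem_union, Finset.mem_sdiff,
      true_and, Finset.mem_image]
    constructor
    · intro hx
      by_cases h : ∃ a ∈ S, a.1 = x
      · obtain ⟨a, ha, rfl⟩ := h
        exact Or.inr ⟨a, ⟨by rintro rfl; exact hx rfl, ha⟩, rfl⟩
      · exact Or.inl h
    · rintro (h | ⟨a, ⟨hac, ha⟩, rfl⟩)
      · rintro rfl; exact h ⟨c, hc, rfl⟩
      · exact hS.fst_ne a ha c hc hac
  rw [hset, Finset.prod_union, Finset.prod_image] at key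
  · refine eq_inv_of_mul_eq_one_left ?_
    refine Eq.trans ?_ key
    congr 1
    · exact Finset.prod_congr rfl fun x _ => by ring
    · exact Finset.prod_congr rfl fun x _ => by rw [mul_one, CharTwo.sub_eq_add, CharTwo.sub_eq_add, add_comm]
  · intro x hx y hy h
    exact hinj (Finset.mem_of_mem_erase hx) (Finset.mem_of_mem_erase hy) h
  · rw [Finset.disjoint_left]
    intro m hm hm'
    exact (Finset.mem_sdiff.mp hm).2 (Finset.image_subset_image (Finset.erase_subset _ _) hm')

/-- If the point `(x₀, y₀)` lies on tangents at sufficiently many points of the arc, then it lies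
on a tangent at every point. -/
lemma IsAffArc.exists_tangentSlope [Fintype F] [CharP F 2] {S T : Finset (F × F)} (hS : IsAffArc S)
    {t : ℕ} (ht : S.card + (t + 1) = Fintype.card F) (hTS : T ⊆ S) (hT : T.card = t + 1) {x₀ y₀ : F}
    (hx₀ : ∀ c ∈ S, c.1 ≠ x₀)
    (hTan : ∀ c ∈ T, ∃ m ∈ tangentSlopes S c, y₀ - c.2 = m * (x₀ - c.1)) {c : F × F} (hc : c ∈ S) :
    ∃ m ∈ tangentSlopes S c, y₀ - c.2 = m * (x₀ - c.1) := by
  classical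
  by_cases hcT : c ∈ T
  · exact hTan c hcT
  have hinf : ∀ U : Finset (F × F), ((0 : F), (0 : F), (1 : F)) ∉ U.image (Prod.mk (1 : F)) := by
    simp
  have hinj : Function.Injective (Prod.mk (1 : F) : F × F → F × F × F) := Prod.mk_right_injective 1
  have hcardX : (Finset.univ \ S.image Prod.fst).card = t + 1 := by
    have h1 := Finset.card_sdiff_add_card_eq_card (Finset.subset_univ (S.image Prod.fst))
    rw [Finset.card_image_of_injOn, Finset.card_univ] at h1
    · omega
    · intro p hp r hr h
      by_contra hne
      exact hS.fst_ne p hp r hr hne h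
  have hx₀' : x₀ ∈ Finset.univ \ S.image Prod.fst := by
    simp only [Finset.mem_sdiff, Finset.mem_univ, true_and, Finset.mem_image, not_exists, not_and]
    exact hx₀
  have hcardM : ∀ d ∈ S, (tangentSlopes S d).card = t + 1 := fun d hd => by
    have := hS.card_tangentSlopes hd; omega
  have key := tangent_prod_eq_zero (K := insert (0, 0, 1) (S.image (Prod.mk (1 : F))))
    (Z := insert (0, 0, 1) (T.image (Prod.mk (1 : F)))) (h := tangentProd S) (n := t)
    (P := (1, x₀, y₀)) (y := (1, c)) ?_ ?_ ?_ ?_ ?_ ?_ ?_ ?_ ?_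
  · rw [tangentProd_affine] at key
    rcases mul_eq_zero.mp key with h | h
    · refine absurd h (inv_ne_zero (Finset.prod_ne_zero_iff.mpr fun e he => sub_ne_zero.mpr ?_))
      exact hS.fst_ne e (Finset.mem_of_mem_erase he) c hc (Finset.ne_of_mem_erase he)
    · obtain ⟨m, hm, h⟩ := Finset.prod_eq_zero_iff.mp h
      refine ⟨m, hm, ?_⟩
      simp only [linForm] at h
      linear_combination h
  · have hlin : ∀ c ∈ S, ∀ d ∈ S, c ≠ d → bracket (0, 0, 1) (1, c) (1, d) ≠ 0 := by
      intro c hc d hd hcd h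
      refine hS.fst_ne c hc d hd hcd ?_
      simp only [bracket] at h
      linear_combination -h
    intro x hx y hy z hz hxy hxz hyz
    simp only [Finset.mem_insert, Finset.mem_image] at hx hy hz
    rcases hx with rfl | ⟨p, hp, rfl⟩ <;> rcases hy with rfl | ⟨r, hr, rfl⟩ <;>
      rcases hz with rfl | ⟨s, hs, rfl⟩
    · exact absurd rfl hxy
    · exact absurd rfl hxy
    · exact absurd rfl hxz
    · exact hlin r hr s hs (by rintro rfl; exact hyz rfl)
    · exact absurd rfl hyz
    · rw [bracket_swap_left]
      exact hlin p hp s hs (by rintro rfl; exact hxz rfl)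
    · rw [bracket_swap_right, bracket_swap_left]
      exact hlin p hp r hr (by rintro rfl; exact hxy rfl)
    · rw [bracket_affine]
      exact hS.det3_ne p hp r hr s hs (by rintro rfl; exact hxy rfl) (by rintro rfl; exact hxz rfl)
        (by rintro rfl; exact hyz rfl)
  · intro x hx y hy hxy
    simp only [Finset.mem_insert, Finset.mem_image] at hx hy
    rcases hx with rfl | ⟨p, hp, rfl⟩ <;> rcases hy with rfl | ⟨r, hr, rfl⟩
    · exact absurd rfl hxy
    · exact hS.tangentProd_infinity hr
    · exact (hS.tangentProd_infinity hp).symm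
    · exact hS.tangentProd_comm hp hr (by rintro rfl; exact hxy rfl)
  · exact Finset.insert_subset_insert _ (Finset.image_subset_image hTS)
  · rw [Finset.card_insert_of_notMem (hinf T), Finset.card_image_of_injective _ hinj, hT]
  · exact Finset.mem_insert_of_mem (Finset.mem_image_of_mem _ hc)
  · simpa [Prod.ext_iff] using hcT
  · have h := isFormProd_prod ((1 : F), c) (tangentSlopes S c) (∏ e ∈ S.erase c, (e.1 - c.1))⁻¹
      (fun m => (m * c.1 - c.2, -m, 1)) (fun m _ => by simp only [linForm]; ring)
    rw [hcardM c hc] at h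
    convert h using 2
    exact tangentProd_affine S c _
  · intro z hz
    simp only [Finset.mem_insert, Finset.mem_image] at hz
    rcases hz with rfl | ⟨d, hd, rfl⟩
    · have h := isFormProd_prod ((0 : F), (0 : F), (1 : F)) ((Finset.univ \ S.image Prod.fst).erase x₀)
        (1 : F) (fun x => (-x, 1, 0)) (fun m _ => by simp only [linForm]; ring)
      rw [Finset.card_erase_of_mem hx₀', hcardX] at h
      refine ⟨_, h, fun w => ?_⟩
      rw [tangentProd, if_pos rfl, ← Finset.mul_prod_erase _ _ hx₀', one_mul]
      congr 1
      simp only [linForm, bracket]; ring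
    · obtain ⟨m, hm, hy⟩ := hTan d hd
      have h := isFormProd_prod ((1 : F), d) ((tangentSlopes S d).erase m)
        ((∏ e ∈ S.erase d, (e.1 - d.1))⁻¹ * (x₀ - d.1)⁻¹)
        (fun m => (m * d.1 - d.2, -m, 1)) (fun m _ => by simp only [linForm]; ring)
      rw [Finset.card_erase_of_mem hm, hcardM d (hTS hd)] at h
      refine ⟨_, h, fun w => ?_⟩
      have h0 := sub_ne_zero.mpr (hx₀ d (hTS hd)).symm
      have hb : bracket (1, d) (1, x₀, y₀) w = (x₀ - d.1) * linForm (m * d.1 - d.2, -m, 1) w := by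
        simp only [bracket, linForm]
        linear_combination (d.1 * w.1 - w.2.1) * hy
      rw [tangentProd_affine, ← Finset.mul_prod_erase _ _ hm, hb]
      field_simp
  · intro z hz w hw hzw
    simp only [Finset.mem_insert, Finset.mem_image] at hz hw
    rcases hz with rfl | ⟨d, hd, rfl⟩ <;> rcases hw with rfl | ⟨e, he, rfl⟩
    · exact absurd rfl hzw
    · intro h
      refine hx₀ e he ?_
      simp only [bracket] at h
      linear_combination h
    · intro h
      refine hx₀ d (hTS hd) ?_
      simp only [bracket] at h
      linear_combination -h
    · obtain ⟨m, hm, hy⟩ := hTan d hd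
      have hed : e ≠ d := by rintro rfl; exact hzw rfl
      have hm' := (mem_tangentSlopes.mp hm).2 e he hed
      have h0 := sub_ne_zero.mpr (hx₀ d (hTS hd)).symm
      rw [bracket_affine]
      have : det3 d (x₀, y₀) e = (x₀ - d.1) * ((e.2 - d.2) - m * (e.1 - d.1)) := by
        simp only [det3]
        linear_combination -(e.1 - d.1) * hy
      rw [this]
      exact mul_ne_zero h0 (sub_ne_zero.mpr hm')

end AffineArc

section AffineArc

variable {F : Type*} [Field F]

lemma det3_swap_right (p q r : F × F) : det3 p q r = -det3 p r q := by
  simp only [det3]; ring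

lemma det3_swap_left (p q r : F × F) : det3 p q r = -det3 q p r := by
  simp only [det3]; ring

open Classical in
lemma IsAffArc.insert_of_tangentSlopes [Fintype F] {S : Finset (F × F)} (hS : IsAffArc S) {P : F × F}
    (hx : ∀ c ∈ S, c.1 ≠ P.1)
    (hP : ∀ c ∈ S, ∃ m ∈ tangentSlopes S c, P.2 - c.2 = m * (P.1 - c.1)) :
    IsAffArc (insert P S) := by
  have hdet : ∀ c ∈ S, ∀ d ∈ S, c ≠ d → det3 c d P ≠ 0 := by
    intro c hc d hd hcd
    obtain ⟨m, hm, h⟩ := hP c hc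
    have h1 := (mem_tangentSlopes.mp hm).2 d hd hcd.symm
    have : det3 c d P = -((P.1 - c.1) * ((d.2 - c.2) - m * (d.1 - c.1))) := by
      simp only [det3]
      linear_combination (d.1 - c.1) * h
    rw [this]
    exact neg_ne_zero.mpr
      (mul_ne_zero (sub_ne_zero.mpr (hx c hc).symm) (sub_ne_zero.mpr h1))
  have hy : ∀ c ∈ S, c.2 ≠ P.2 := by
    intro c hc h
    obtain ⟨m, hm, h1⟩ := hP c hc
    rw [h, sub_self, eq_comm, mul_eq_zero] at h1
    exact h1.elim (mem_tangentSlopes.mp hm).1 (sub_ne_zero.mpr (hx c hc).symm)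
  refine ⟨?_, ?_, ?_⟩
  · intro p hp q hq hpq
    rcases Finset.mem_insert.mp hp with hp | hp <;> rcases Finset.mem_insert.mp hq with hq | hq
    · exact absurd (hp.trans hq.symm) hpq
    · rw [hp]; exact (hx q hq).symm
    · rw [hq]; exact hx p hp
    · exact hS.fst_ne p hp q hq hpq
  · intro p hp q hq hpq
    rcases Finset.mem_insert.mp hp with hp | hp <;> rcases Finset.mem_insert.mp hq with hq | hq
    · exact absurd (hp.trans hq.symm) hpq
    · rw [hp]; exact (hy q hq).symm
    · rw [hq]; exact hy p hp
    · exact hS.snd_ne p hp q hq hpq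
  · intro p hp q hq r hr hpq hpr hqr
    rcases Finset.mem_insert.mp hp with hp | hp <;> rcases Finset.mem_insert.mp hq with hq | hq <;>
      rcases Finset.mem_insert.mp hr with hr | hr
    · exact absurd (hp.trans hq.symm) hpq
    · exact absurd (hp.trans hq.symm) hpq
    · exact absurd (hp.trans hr.symm) hpr
    · rw [hp, det3_swap_left, det3_swap_right, neg_neg]
      exact hdet q hq r hr hqr
    · exact absurd (hq.trans hr.symm) hqr
    · rw [hq, det3_swap_right]
      exact neg_ne_zero.mpr (hdet p hp r hr hpr)
    · rw [hr]
      exact hdet p hp q hq hpq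
    · exact hS.det3_ne p hp q hq r hr hpq hpr hqr

open Classical in
/-- A large affine arc is contained in a larger one. -/
lemma IsAffArc.exists_insert [Fintype F] [CharP F 2] {S : Finset (F × F)} (hS : IsAffArc S) {t : ℕ}
    (ht : S.card + (t + 1) = Fintype.card F) (htq : (t + 1) * (t + 1) < Fintype.card F) :
    ∃ P ∉ S, IsAffArc (insert P S) := by
  obtain ⟨x₀, hx₀⟩ : ∃ x₀, x₀ ∉ S.image Prod.fst := by
    by_contra! h
    have h1 : Fintype.card F ≤ (S.image Prod.fst).card := by
      rw [← Finset.card_univ]; exact Finset.card_le_card fun x _ => h x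
    have := h1.trans Finset.card_image_le
    omega
  have hx : ∀ c ∈ S, c.1 ≠ x₀ := fun c hc h => hx₀ (Finset.mem_image.mpr ⟨c, hc, h⟩)
  have hcard : (S.sigma fun c => tangentSlopes S c).card = S.card * (t + 1) := by
    rw [Finset.card_sigma, Finset.sum_const_nat fun c hc => ?_]
    have := hS.card_tangentSlopes hc
    omega
  obtain ⟨y₀, -, hy₀⟩ := Finset.exists_lt_card_fiber_of_mul_lt_card_of_maps_to
    (s := S.sigma fun c => tangentSlopes S c) (t := (Finset.univ : Finset F))
    (f := fun p => p.1.2 + p.2 * (x₀ - p.1.1)) (n := t) (fun _ _ => Finset.mem_univ _) (by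
      rw [hcard, Finset.card_univ, ← ht]
      rw [← ht] at htq
      nlinarith)
  have hle : t + 1 ≤ (S.filter fun c => ∃ m ∈ tangentSlopes S c, y₀ - c.2 = m * (x₀ - c.1)).card := by
    refine (Nat.succ_le_of_lt hy₀).trans ?_
    refine Finset.card_le_card_of_injOn (fun p => p.1) ?_ ?_
    · rintro ⟨c, m⟩ h
      simp only [Finset.coe_filter, Finset.mem_sigma, Set.mem_ofPred_eq] at h ⊢
      exact ⟨h.1.1, m, h.1.2, by rw [← h.2]; ring⟩
    · rintro ⟨c, m⟩ h ⟨d, n⟩ h' hcd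
      simp only [Finset.coe_filter, Finset.mem_sigma, Set.mem_ofPred_eq] at h h' hcd
      subst hcd
      have := mul_right_cancel₀ (sub_ne_zero.mpr (hx c h.1.1).symm)
        (add_left_cancel (h.2.trans h'.2.symm))
      rw [this]
  obtain ⟨T, hT, hTc⟩ := Finset.exists_subset_card_eq hle
  refine ⟨(x₀, y₀), fun h => hx _ h rfl, hS.insert_of_tangentSlopes hx fun c hc => ?_⟩
  exact hS.exists_tangentSlope ht (hT.trans (Finset.filter_subset _ _)) hTc hx
    (fun c hc => (Finset.mem_filter.mp (hT hc)).2) hc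

/-- A large affine arc is contained in the graph of an oval function. -/
lemma IsAffArc.exists_isOvalFun [Fintype F] [CharP F 2] (t : ℕ) :
    ∀ {S : Finset (F × F)}, IsAffArc S → S.card + t = Fintype.card F → t * t < Fintype.card F →
      ∃ f : F → F, IsOvalFun f ∧ ∀ p ∈ S, f p.1 = p.2 := by
  classical
  induction t with
  | zero =>
    intro S hS hc _
    have hinj : Set.InjOn Prod.fst (S : Set (F × F)) := by
      intro p hp r hr h
      by_contra hne
      exact hS.fst_ne p hp r hr hne h
    have himg : S.image Prod.fst = Finset.univ := by
      rw [← Finset.card_eq_iff_eq_univ, Finset.card_image_of_injOn hinj]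
      simpa using hc
    have hex : ∀ x, ∃ y, (x, y) ∈ S := by
      intro x
      obtain ⟨p, hp, rfl⟩ := Finset.mem_image.mp (himg ▸ Finset.mem_univ x)
      exact ⟨p.2, hp⟩
    choose f hf using hex
    refine ⟨f, ⟨?_, ?_⟩, ?_⟩
    · intro x y h
      by_contra hne
      exact hS.snd_ne _ (hf x) _ (hf y) (fun e => hne (Prod.ext_iff.mp e).1) h
    · intro x y z hxy hxz hyz
      exact hS.det3_ne _ (hf x) _ (hf y) _ (hf z) (fun e => hxy (Prod.ext_iff.mp e).1)
        (fun e => hxz (Prod.ext_iff.mp e).1) (fun e => hyz (Prod.ext_iff.mp e).1)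
    · intro p hp
      by_contra hne
      exact hS.fst_ne _ (hf p.1) p hp (fun e => hne (Prod.ext_iff.mp e).2) rfl
  | succ t ih =>
    intro S hS hc ht
    obtain ⟨P, hP, hPS⟩ := hS.exists_insert hc ht
    obtain ⟨f, hf, hfS⟩ := ih hPS (by rw [Finset.card_insert_of_notMem hP]; omega) (by nlinarith)
    exact ⟨f, hf, fun p hp => hfS p (Finset.mem_insert_of_mem hp)⟩

end AffineArc

section Inversion

variable {F : Type*} [Field F]

/-- The image of a point under coordinatewise inversion centred at `c`. -/
def invAt (c p : F × F) : F × F := ((p.1 - c.1)⁻¹, (p.2 - c.2)⁻¹)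

lemma invAt_self (c : F × F) : invAt c c = 0 := by simp [invAt]

lemma invAt_injective (c : F × F) : Function.Injective (invAt c) := by
  intro p q h
  simp only [invAt, Prod.mk.injEq, inv_inj, sub_left_inj] at h
  exact Prod.ext h.1 h.2

/-- If `c`, `d`, `P`, `e` lie on a hyperbola with axial asymptotes, then the collinearity of the
inverted points does not depend on the centre of inversion. -/
lemma det3_invAt_eq_zero_comm {c d P e : F × F} (hcd : d.1 ≠ c.1 ∧ d.2 ≠ c.2)
    (hP : P.1 ≠ d.1 ∧ P.2 ≠ d.2) (he : e.1 ≠ d.1 ∧ e.2 ≠ d.2)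
    (hP' : P.1 ≠ c.1 ∧ P.2 ≠ c.2) (he' : e.1 ≠ c.1 ∧ e.2 ≠ c.2)
    (h : det3 (invAt d c) (invAt d P) (invAt d e) = 0) :
    det3 (invAt c d) (invAt c P) (invAt c e) = 0 := by
  have key : ∀ {d p q r : F × F}, p.1 ≠ d.1 ∧ p.2 ≠ d.2 → q.1 ≠ d.1 ∧ q.2 ≠ d.2 →
      r.1 ≠ d.1 ∧ r.2 ≠ d.2 → det3 (invAt d p) (invAt d q) (invAt d r) *
        (((p.1 - d.1) * (p.2 - d.2)) * ((q.1 - d.1) * (q.2 - d.2)) *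
          ((r.1 - d.1) * (r.2 - d.2))) =
      bracket (p.2 - d.2, p.1 - d.1, (p.1 - d.1) * (p.2 - d.2))
        (q.2 - d.2, q.1 - d.1, (q.1 - d.1) * (q.2 - d.2))
        (r.2 - d.2, r.1 - d.1, (r.1 - d.1) * (r.2 - d.2)) := by
    intro d p q r hp hq hr
    have h1 := sub_ne_zero.mpr hp.1
    have h2 := sub_ne_zero.mpr hp.2
    have h3 := sub_ne_zero.mpr hq.1
    have h4 := sub_ne_zero.mpr hq.2
    have h5 := sub_ne_zero.mpr hr.1
    have h6 := sub_ne_zero.mpr hr.2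
    simp only [det3, invAt, bracket]
    field_simp
    ring
  have h1 := key ⟨hcd.1.symm, hcd.2.symm⟩ hP he
  have h2 := key hcd hP' he'
  rw [h, zero_mul] at h1
  refine (mul_eq_zero.mp (h2.trans ?_)).resolve_right ?_
  · simp only [bracket] at h1 ⊢
    linear_combination h1
  · simp only [mul_ne_zero_iff, sub_ne_zero]
    exact ⟨⟨hcd, hP'⟩, he'⟩

lemma IsOvalFun.exists_slope_eq [Finite F] {f : F → F} (hf : IsOvalFun f) (u : F) {m : F}
    (hm : m ≠ 0) : ∃ x ≠ u, f x - f u = m * (x - u) := by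
  let s : {x : F // x ≠ u} → {m : F // m ≠ 0} := fun x => ⟨(f x - f u) / (x - u),
    div_ne_zero (sub_ne_zero.mpr (hf.inj.ne x.2)) (sub_ne_zero.mpr x.2)⟩
  have hs : Function.Injective s := by
    rintro ⟨x, hx⟩ ⟨y, hy⟩ h
    by_contra hne
    refine hf.det3_ne u x y hx.symm hy.symm (fun e => hne (Subtype.ext e)) ?_
    simp only [s, Subtype.mk.injEq] at h
    rw [div_eq_div_iff (sub_ne_zero.mpr hx) (sub_ne_zero.mpr hy)] at h
    simp only [det3]
    linear_combination -h
  have e : {x : F // x ≠ u} ≃ {m : F // m ≠ 0} := by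
    classical
    haveI := Fintype.ofFinite F
    refine Fintype.equivOfCardEq ?_
    rw [Fintype.card_subtype_compl, Fintype.card_subtype_compl]
    simp
  have hsurj : Function.Surjective s := by
    have := (Finite.injective_iff_surjective (f := e.symm ∘ s)).mp (e.symm.injective.comp hs)
    intro b
    obtain ⟨a, ha⟩ := this (e.symm b)
    exact ⟨a, e.symm.injective ha⟩
  obtain ⟨⟨x, hx⟩, h⟩ := hsurj ⟨m, hm⟩
  refine ⟨x, hx, ?_⟩
  simp only [s, Subtype.mk.injEq] at h
  rw [← h, div_mul_cancel₀ _ (sub_ne_zero.mpr hx)]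

/-- Three points of the graph of an oval function on a line are not distinct. -/
lemma IsOvalFun.eq_of_slope_eq {f : F → F} (hf : IsOvalFun f) {x y z m : F} (hxz : x ≠ z)
    (hyz : y ≠ z) (h1 : f z - f x = m * (z - x)) (h2 : f z - f y = m * (z - y)) : x = y := by
  by_contra hxy
  refine hf.det3_ne x y z hxy hxz hyz ?_
  simp only [det3]
  linear_combination (y - z) * h1 - (x - z) * h2

open Classical in
lemma card_compl_image [Fintype F] {S : Finset (F × F)} (hS : IsAffArc S) {t : ℕ}
    (ht : S.card + t = Fintype.card F) : (Finset.univ \ S.image Prod.fst).card = t := by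
  have h1 := Finset.card_sdiff_add_card_eq_card (Finset.subset_univ (S.image Prod.fst))
  rw [Finset.card_image_of_injOn, Finset.card_univ] at h1
  · omega
  · intro p hp r hr h
    by_contra hne
    exact hS.fst_ne p hp r hr hne h

section Compare

variable [Fintype F] {S : Finset (F × F)} {t : ℕ} {f : F → F} {g : F × F → F → F}

open Classical in
lemma card_filter_bad_le (hS : IsAffArc S) (ht : S.card + t = Fintype.card F)
    (hf : IsOvalFun f) (hfS : ∀ p ∈ S, f p.1 = p.2) (hg : ∀ c ∈ S, IsOvalFun (g c))
    (hgS : ∀ c ∈ S, ∀ p ∈ S, g c (p.1 - c.1)⁻¹ = (p.2 - c.2)⁻¹) {x₀ : F}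
    (hx₀ : ∀ c ∈ S, c.1 ≠ x₀) :
    (S.filter fun c => g c (x₀ - c.1)⁻¹ ≠ (f x₀ - c.2)⁻¹).card ≤ t * t := by
  have hbij : Function.Surjective f := Finite.surjective_of_injective hf.inj
  set X := (Finset.univ : Finset F) \ S.image Prod.fst with hX
  have hmemX : ∀ x, (∀ p ∈ S, p.1 ≠ x) → x ∈ X := by
    intro x h
    simpa [hX, Finset.mem_sdiff] using fun b hb => h (x, b) hb rfl
  have hex : ∀ c ∈ S.filter (fun c => g c (x₀ - c.1)⁻¹ ≠ (f x₀ - c.2)⁻¹), ∃ z : F × F,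
      z ∈ X ×ˢ X ∧ ∃ m, f z.2 - c.2 = m * (z.2 - c.1) ∧ f z.1 - c.2 = m * (x₀ - c.1) ∧
        z.2 ≠ x₀ ∧ c.1 ≠ z.2 := by
    intro c hc
    obtain ⟨hc, hbad⟩ := Finset.mem_filter.mp hc
    have hxc := sub_ne_zero.mpr (hx₀ c hc).symm
    have hg0 : g c 0 = 0 := by simpa using hgS c hc c hc
    set w := g c (x₀ - c.1)⁻¹ with hw
    have hw0 : w ≠ 0 := by
      intro h
      exact inv_ne_zero hxc ((hg c hc).inj (h.trans hg0.symm))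
    obtain ⟨x₂, hx₂⟩ := hbij (c.2 + w⁻¹)
    obtain ⟨x₃, hx₃, h₃⟩ := hf.exists_slope_eq c.1 (m := w⁻¹ / (x₀ - c.1))
      (div_ne_zero (inv_ne_zero hw0) hxc)
    rw [hfS c hc] at h₃
    refine ⟨(x₂, x₃), Finset.mem_product.mpr ⟨hmemX _ ?_, hmemX _ ?_⟩, w⁻¹ / (x₀ - c.1), h₃, ?_, ?_,
      hx₃.symm⟩
    · rintro p hp rfl
      rw [hfS p hp] at hx₂
      have h1 := hgS c hc p hp
      rw [hx₂, add_sub_cancel_left, inv_inv, hw] at h1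
      have h2 := (hg c hc).inj h1
      rw [inv_inj, sub_left_inj] at h2
      exact hx₀ p hp h2
    · rintro p hp rfl
      rw [hfS p hp] at h₃
      have hpc := sub_ne_zero.mpr hx₃
      have h1 := hgS c hc p hp
      refine (hg c hc).det3_ne 0 (p.1 - c.1)⁻¹ (x₀ - c.1)⁻¹ (inv_ne_zero hpc).symm
        (inv_ne_zero hxc).symm ?_ ?_
      · rw [ne_eq, inv_inj, sub_left_inj]
        exact hx₀ p hp
      · rw [h1, h₃, hg0, ← hw]
        simp only [det3]
        field_simp
        ring
    · rw [hx₂]; field_simp; ring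
    · rintro rfl
      refine hbad ?_
      rw [h₃]; field_simp
  choose! z hz m hm using hex
  rw [← card_compl_image hS ht, ← hX, ← Finset.card_product]
  refine Finset.card_le_card_of_injOn z hz ?_
  intro c hc d hd hcd
  obtain ⟨h1, h2, h3, h4⟩ := hm c hc
  obtain ⟨h1', h2', h3', h4'⟩ := hm d hd
  rw [← hcd] at h1' h2' h3' h4'
  have hmm : m c = m d := by
    refine mul_right_cancel₀ (sub_ne_zero.mpr h3) ?_
    linear_combination h2 - h1 + h1' - h2'
  have hcS := (Finset.mem_filter.mp hc).1
  have hdS := (Finset.mem_filter.mp hd).1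
  have := hf.eq_of_slope_eq h4 h4' (by rw [hfS c hcS]; exact h1)
    (by rw [hfS d hdS, hmm]; exact h1')
  by_contra hne
  exact hS.fst_ne c hcS d hdS hne this

open Classical in
lemma card_filter_good_le (hS : IsAffArc S) (hSinv : ∀ c ∈ S, IsAffArc (S.image (invAt c)))
    (ht : S.card + t = Fintype.card F)
    (hf : IsOvalFun f) (hfS : ∀ p ∈ S, f p.1 = p.2) (hg : ∀ c ∈ S, IsOvalFun (g c))
    (hgS : ∀ c ∈ S, ∀ p ∈ S, g c (p.1 - c.1)⁻¹ = (p.2 - c.2)⁻¹) {x₀ : F}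
    (hx₀ : ∀ c ∈ S, c.1 ≠ x₀) {d : F × F} (hd : d ∈ S)
    (hbad : g d (x₀ - d.1)⁻¹ ≠ (f x₀ - d.2)⁻¹) :
    (S.filter fun c => g c (x₀ - c.1)⁻¹ = (f x₀ - c.2)⁻¹).card ≤ t := by
  have hyne : ∀ c ∈ S, f x₀ ≠ c.2 := by
    intro c hc h
    rw [← hfS c hc] at h
    exact hx₀ c hc (hf.inj h).symm
  set X := (Finset.univ : Finset F) \ (S.image (invAt d)).image Prod.fst with hX
  set a := (x₀ - d.1)⁻¹ with ha
  set b := (f x₀ - d.2)⁻¹ with hb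
  have hg0 : g d 0 = 0 := by simpa using hgS d hd d hd
  have hex : ∀ c ∈ S.filter (fun c => g c (x₀ - c.1)⁻¹ = (f x₀ - c.2)⁻¹), ∃ z,
      z ∈ X ∧ ∃ m, g d z - g d (c.1 - d.1)⁻¹ = m * (z - (c.1 - d.1)⁻¹) ∧
        b - g d (c.1 - d.1)⁻¹ = m * (a - (c.1 - d.1)⁻¹) ∧ z ≠ a ∧ (c.1 - d.1)⁻¹ ≠ z := by
    intro c hc
    obtain ⟨hc, hgood⟩ := Finset.mem_filter.mp hc
    have hcd : c ≠ d := by rintro rfl; exact hbad hgood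
    have hap : a - (c.1 - d.1)⁻¹ ≠ 0 := by
      rw [sub_ne_zero, ha, ne_eq, inv_inj, sub_left_inj]
      exact (hx₀ c hc).symm
    have hbr : b - (c.2 - d.2)⁻¹ ≠ 0 := by
      rw [sub_ne_zero, hb, ne_eq, inv_inj, sub_left_inj]
      exact hyne c hc
    obtain ⟨x', hx', h'⟩ := (hg d hd).exists_slope_eq (c.1 - d.1)⁻¹
      (m := (b - (c.2 - d.2)⁻¹) / (a - (c.1 - d.1)⁻¹)) (div_ne_zero hbr hap)
    refine ⟨x', ?_, _, h', by rw [hgS d hd c hc, div_mul_cancel₀ _ hap], ?_, hx'.symm⟩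
    · rw [hgS d hd c hc, div_mul_eq_mul_div, eq_div_iff hap] at h'
      simp only [hX, Finset.mem_sdiff, Finset.mem_univ, true_and, Finset.mem_image, not_exists,
        not_and]
      rintro _ ⟨e, he, rfl⟩ rfl
      rw [show g d (invAt d e).1 = (e.2 - d.2)⁻¹ from hgS d hd e he] at h'
      have hcol : det3 (invAt d c) (invAt d (x₀, f x₀)) (invAt d e) = 0 := by
        simp only [det3, invAt, ← ha, ← hb] at h' ⊢
        linear_combination h'
      by_cases hed : e = d
      · subst hed
        rw [invAt_self] at hcol
        have h1 := sub_ne_zero.mpr (hS.fst_ne c hc e hd hcd)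
        have h2 := sub_ne_zero.mpr (hS.snd_ne c hc e hd hcd)
        have h3 := sub_ne_zero.mpr (hx₀ e hd).symm
        have h4 := sub_ne_zero.mpr (hyne e hd)
        refine hf.det3_ne e.1 c.1 x₀ (hS.fst_ne c hc e hd hcd).symm (hx₀ e hd) (hx₀ c hc) ?_
        rw [hfS e hd, hfS c hc]
        simp only [det3, invAt, Prod.fst_zero, Prod.snd_zero] at hcol ⊢
        field_simp at hcol
        linear_combination -hcol
      · have hec : e ≠ c := by rintro rfl; exact hx' rfl
        have hcol' := det3_invAt_eq_zero_comm
          ⟨hS.fst_ne d hd c hc hcd.symm, hS.snd_ne d hd c hc hcd.symm⟩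
          ⟨(hx₀ d hd).symm, hyne d hd⟩ ⟨hS.fst_ne e he d hd hed, hS.snd_ne e he d hd hed⟩
          ⟨(hx₀ c hc).symm, hyne c hc⟩ ⟨hS.fst_ne e he c hc hec, hS.snd_ne e he c hc hec⟩ hcol
        refine (hg c hc).det3_ne (d.1 - c.1)⁻¹ (x₀ - c.1)⁻¹ (e.1 - c.1)⁻¹ ?_ ?_ ?_ ?_
        · rw [ne_eq, inv_inj, sub_left_inj]; exact hx₀ d hd
        · rw [ne_eq, inv_inj, sub_left_inj]; exact hS.fst_ne d hd e he (Ne.symm hed)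
        · rw [ne_eq, inv_inj, sub_left_inj]; exact (hx₀ e he).symm
        · rw [hgS c hc d hd, hgS c hc e he, hgood]
          exact hcol'
    · rintro rfl
      refine hbad ?_
      rw [hgS d hd c hc, div_mul_cancel₀ _ hap] at h'
      exact sub_left_injective h'
  choose! z hz m hm using hex
  have hXc : X.card = t := card_compl_image (hSinv d hd)
    (by rw [Finset.card_image_of_injective _ (invAt_injective d), ht])
  rw [← hXc]
  refine Finset.card_le_card_of_injOn z hz ?_
  intro c hc e he hce
  obtain ⟨h1, h2, h3, h4⟩ := hm c hc
  obtain ⟨h1', h2', h3', h4'⟩ := hm e he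
  rw [← hce] at h1' h3' h4'
  have hmm : m c = m e := by
    refine mul_right_cancel₀ (sub_ne_zero.mpr h3) ?_
    linear_combination h2 - h1 + h1' - h2'
  have := (hg d hd).eq_of_slope_eq h4 h4' h1 (by rw [hmm]; exact h1')
  rw [inv_inj, sub_left_inj] at this
  by_contra hne
  exact hS.fst_ne c (Finset.mem_filter.mp hc).1 e (Finset.mem_filter.mp he).1 hne this

open Classical in
/-- The oval function through a large arc is compatible with inversion at the points of the arc. -/
lemma invAt_eq_of_isOvalFun (hS : IsAffArc S) (hSinv : ∀ c ∈ S, IsAffArc (S.image (invAt c)))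
    (ht : S.card + t = Fintype.card F) (htq : (t + 1) * (t + 1) ≤ Fintype.card F)
    (hf : IsOvalFun f) (hfS : ∀ p ∈ S, f p.1 = p.2) (hg : ∀ c ∈ S, IsOvalFun (g c))
    (hgS : ∀ c ∈ S, ∀ p ∈ S, g c (p.1 - c.1)⁻¹ = (p.2 - c.2)⁻¹) {c : F × F} (hc : c ∈ S) (x : F) :
    g c (x - c.1)⁻¹ = (f x - c.2)⁻¹ := by
  by_cases hx : ∃ p ∈ S, p.1 = x
  · obtain ⟨p, hp, rfl⟩ := hx
    rw [hgS c hc p hp, hfS p hp]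
  push Not at hx
  by_contra hbad
  have h1 := card_filter_bad_le hS ht hf hfS hg hgS hx
  have h2 := card_filter_good_le hS hSinv ht hf hfS hg hgS hx hc hbad
  have h3 := Finset.card_filter_add_card_filter_not (s := S)
    (fun c => g c (x - c.1)⁻¹ = (f x - c.2)⁻¹)
  nlinarith

end Compare

end Inversion

section Monomial

open Polynomial

variable {F : Type*} [Field F]

/-- The power sums `∑ (f x + m x) ^ j` of an oval function vanish. -/
lemma IsOvalFun.sum_add_mul_pow_eq_zero [Fintype F] [CharP F 2] {f : F → F} (hf : IsOvalFun f)
    {m : F} (hm : m ≠ 0) (j : ℕ) : ∑ x, (f x + m * x) ^ j = 0 := by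
  choose s hs hfs using fun x => hf.exists_slope_eq x hm
  refine Finset.sum_involution (fun x _ => s x) ?_ ?_ (fun _ _ => Finset.mem_univ _) ?_
  · intro x _
    have : f x + m * x = f (s x) + m * s x := by
      have h := hfs x
      rw [CharTwo.sub_eq_add, CharTwo.sub_eq_add] at h
      rw [← CharTwo.add_eq_zero]
      have h2 : f (s x) + f x + m * (s x + x) = 0 := by rw [h, CharTwo.add_self_eq_zero]
      linear_combination h2
    rw [this, CharTwo.add_self_eq_zero]
  · intro x _ _
    exact hs x
  · intro x _
    refine hf.eq_of_slope_eq (m := m) (hs (s x)) (hs x).symm ?_ (hfs x)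
    linear_combination -hfs (s x)

/-- Even power moments of an oval function vanish. -/
lemma IsOvalFun.sum_pow_mul_eq_zero [Fintype F] [CharP F 2] {f : F → F} (hf : IsOvalFun f)
    {l : ℕ} (hl : 2 * l + 2 ≤ Fintype.card F) (h4 : 4 ≤ Fintype.card F) :
    ∑ x, x ^ (2 * l) * f x = 0 := by
  set q := Fintype.card F with hq
  have h0 : ∑ m : F, m ^ (q - 1 - 2 * l) * ∑ x, (m * x + f x) ^ (2 * l + 1) = 0 := by
    refine Finset.sum_eq_zero fun m _ => ?_
    by_cases hm : m = 0
    · rw [hm, zero_pow (by omega), zero_mul]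
    · rw [Finset.sum_congr rfl fun x _ => by rw [add_comm], hf.sum_add_mul_pow_eq_zero hm, mul_zero]
  have h1 : ∑ m : F, m ^ (q - 1 - 2 * l) * ∑ x, (m * x + f x) ^ (2 * l + 1) =
      ∑ k ∈ Finset.range (2 * l + 2), (∑ m : F, m ^ (q - 1 - 2 * l + k)) *
        ∑ x, x ^ k * f x ^ (2 * l + 1 - k) * ((2 * l + 1).choose k : F) := by
    simp only [add_pow, Finset.mul_sum, Finset.sum_mul]
    rw [Finset.sum_congr rfl fun m _ => Finset.sum_comm, Finset.sum_comm]
    refine Finset.sum_congr rfl fun k _ => ?_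
    rw [Finset.sum_comm]
    refine Finset.sum_congr rfl fun x _ => Finset.sum_congr rfl fun m _ => ?_
    ring
  rw [h1, Finset.sum_eq_single (2 * l)] at h0
  · rw [show q - 1 - 2 * l + 2 * l = q - 1 by omega] at h0
    have h2 : ∑ m : F, m ^ (q - 1) = -1 := by
      classical
      rw [← Finset.add_sum_erase _ _ (Finset.mem_univ 0), zero_pow (by omega), zero_add,
        Finset.sum_congr rfl fun m hm => FiniteField.pow_card_sub_one_eq_one m
          (Finset.ne_of_mem_erase hm), Finset.sum_const, Finset.card_erase_of_mem (Finset.mem_univ 0),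
        Finset.card_univ, nsmul_one, Nat.cast_sub (by omega), FiniteField.cast_card_eq_zero]
      simp
    rw [h2] at h0
    have h3 : ((2 * l + 1).choose (2 * l) : F) = 1 := by
      rw [Nat.choose_succ_self_right]
      push_cast
      rw [CharTwo.two_eq_zero]; ring
    simp only [h3, mul_one, show 2 * l + 1 - 2 * l = 1 by omega, pow_one] at h0
    linear_combination -h0
  · intro k hk hne
    rw [Finset.mem_range] at hk
    have : ∑ m : F, m ^ (q - 1 - 2 * l + k) = 0 := by
      rcases lt_or_gt_of_ne hne with h | h
      · exact FiniteField.sum_pow_lt_card_sub_one F _ (by omega)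
      · rw [show q - 1 - 2 * l + k = q by omega, Finset.sum_congr rfl fun m _ =>
          FiniteField.pow_card m]
        have := FiniteField.sum_pow_lt_card_sub_one F 1 (by omega)
        simpa using this
    rw [this, zero_mul]
  · intro h
    simp at h

/-- A function orthogonal to small powers is a polynomial of small degree. -/
lemma exists_polynomial_of_sum_eq_zero [Fintype F] [CharP F 2] {φ : F → F} {N : ℕ} (hN : 1 ≤ N)
    (hq : Fintype.card F = 2 * N) (h : ∀ l < N, ∑ x, x ^ l * φ x = 0) :
    ∃ p : F[X], p.natDegree < N ∧ ∀ a, p.eval a = φ a := by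
  classical
  set M : ℕ → F := fun l => ∑ x, x ^ l * φ x with hM
  refine ⟨∑ k ∈ Finset.range N, C (M (2 * N - 1 - k) * ((2 * N - 1).choose k : F)) * X ^ k, ?_,
    fun a => ?_⟩
  · refine Nat.lt_of_le_pred hN (Polynomial.natDegree_sum_le_of_forall_le _ _ fun k hk => ?_)
    exact (natDegree_C_mul_X_pow_le _ _).trans (Nat.le_pred_of_lt (Finset.mem_range.mp hk))
  · have h1 : φ a = ∑ x, (1 - (a + x) ^ (2 * N - 1)) * φ x := by
      rw [Finset.sum_eq_single a]
      · rw [CharTwo.add_self_eq_zero, zero_pow (by omega)]; ring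
      · intro x _ hx
        rw [← hq, FiniteField.pow_card_sub_one_eq_one, sub_self, zero_mul]
        rw [← CharTwo.sub_eq_add, sub_ne_zero]
        exact hx.symm
      · simp
    have h2 : ∑ x, (1 - (a + x) ^ (2 * N - 1)) * φ x =
        ∑ k ∈ Finset.range (2 * N), a ^ k * M (2 * N - 1 - k) * ((2 * N - 1).choose k : F) := by
      have h0 := h 0 (by omega)
      simp only [pow_zero, one_mul] at h0
      simp only [sub_mul, one_mul, Finset.sum_sub_distrib, h0, zero_sub, CharTwo.neg_eq, add_pow,
        hM, Finset.mul_sum, Finset.sum_mul]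
      rw [Finset.sum_comm, show 2 * N - 1 + 1 = 2 * N by omega]
      refine Finset.sum_congr rfl fun k _ => Finset.sum_congr rfl fun x _ => ?_
      ring
    rw [h1, h2, eval_finsetSum]
    simp only [eval_mul, eval_C, eval_pow, eval_X]
    rw [two_mul, Finset.sum_range_add, ← two_mul]
    have h3 : ∑ x ∈ Finset.range N, a ^ (N + x) * M (2 * N - 1 - (N + x)) *
        ((2 * N - 1).choose (N + x) : F) = 0 := by
      refine Finset.sum_eq_zero fun k hk => ?_
      rw [Finset.mem_range] at hk
      rw [show M (2 * N - 1 - (N + k)) = 0 from h _ (by omega)]; ring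
    rw [h3, add_zero]
    exact Finset.sum_congr rfl fun k _ => by ring

/-- An oval function whose inverted function is also an oval function is a monomial. -/
lemma IsOvalFun.exists_eq_mul_pow [Fintype F] [CharP F 2] {f g : F → F} (hf : IsOvalFun f)
    (hg : IsOvalFun g) (hf0 : f 0 = 0) (hfg : ∀ x, g x⁻¹ = (f x)⁻¹) {N : ℕ} (hN : 2 ≤ N)
    (hq : Fintype.card F = 2 * N) :
    ∃ γ : F, ∃ e : ℕ, γ ≠ 0 ∧ e < Fintype.card F ∧ ∀ x, f x = γ * x ^ e := by
  have hpow : ∀ y : F, (y ^ N) ^ 2 = y := fun y => by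
    rw [← pow_mul, mul_comm N, ← hq, FiniteField.pow_card]
  obtain ⟨p, hp, hpf⟩ := exists_polynomial_of_sum_eq_zero (φ := fun x => f x ^ N) (by omega) hq (by
    intro l hl
    rw [← sq_eq_zero_iff, CharTwo.sum_sq, ← hf.sum_pow_mul_eq_zero (l := l) (by omega) (by omega)]
    refine Finset.sum_congr rfl fun x _ => ?_
    rw [mul_pow, hpow, ← pow_mul, mul_comm l])
  obtain ⟨r, hr, hrf⟩ := exists_polynomial_of_sum_eq_zero (φ := fun x => (x / f x) ^ N)
    (by omega) hq (by
    intro l hl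
    have hg0 : g 0 = 0 := by simpa [hf0] using hfg 0
    rw [← sq_eq_zero_iff, CharTwo.sum_sq,
      ← hg.sum_pow_mul_eq_zero (l := N - 1 - l) (by omega) (by omega),
      ← Equiv.sum_comp (Equiv.inv F) (fun x => x ^ (2 * (N - 1 - l)) * g x)]
    refine Finset.sum_congr rfl fun x _ => ?_
    rw [mul_pow, hpow, ← pow_mul, mul_comm l, Equiv.inv_apply, hfg]
    by_cases hx : x = 0
    · simp [hx, hf0]
    · have h1 : x ^ (2 * l) * x * x ^ (2 * (N - 1 - l)) = 1 := by
        rw [← pow_succ, ← pow_add, show 2 * l + 1 + 2 * (N - 1 - l) = Fintype.card F - 1 by omega]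
        exact FiniteField.pow_card_sub_one_eq_one x hx
      rw [inv_pow, div_eq_mul_inv, ← mul_assoc, eq_inv_of_mul_eq_one_left h1])
  have hprod : p * r = X ^ N := by
    rw [← sub_eq_zero]
    refine Polynomial.eq_zero_of_natDegree_lt_card_of_eval_eq_zero _ Function.injective_id
      (fun x => ?_) ?_
    · simp only [id, eval_sub, eval_mul, hpf, hrf, eval_pow, eval_X]
      by_cases hx : x = 0
      · simp [hx, hf0, zero_pow (show N ≠ 0 by omega)]
      · have : f x ≠ 0 := by rw [← hf0]; exact hf.inj.ne hx
        rw [← mul_pow, mul_div_cancel₀ _ this, sub_self]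
    · refine (natDegree_sub_le _ _).trans_lt ?_
      rw [natDegree_X_pow, hq]
      have := natDegree_mul_le (p := p) (q := r)
      exact max_lt (by omega) (by omega)
  obtain ⟨k, hk, u, hu⟩ := (dvd_prime_pow (prime_X (R := F)) N).mp (Dvd.intro _ hprod)
  obtain ⟨c, hc, hcu⟩ := Polynomial.isUnit_iff.mp (u⁻¹).isUnit
  have hpc : p = X ^ k * C c := by rw [hcu, ← hu, mul_assoc, Units.mul_inv, mul_one]
  have hkN : k < N := by
    rw [hpc, natDegree_mul_C hc.ne_zero, natDegree_X_pow] at hp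
    exact hp
  refine ⟨c ^ 2, k * 2, pow_ne_zero 2 hc.ne_zero, by omega, fun x => ?_⟩
  rw [← hpow (f x), ← hpf, hpc, eval_mul, eval_C, eval_pow, eval_X]
  ring

/-- A shifted power is a monomial only if the exponent is a power of two. -/
lemma exists_eq_two_pow [Fintype F] [CharP F 2] {a b δ : F} {e e' : ℕ} (ha : a ≠ 0) (hδ : δ ≠ 0)
    (he : e < Fintype.card F) (he' : e' < Fintype.card F) (he0 : e ≠ 0)
    (h : ∀ x, a * (x + δ) ^ e - a * δ ^ e = b * x ^ e') : ∃ i, e' = 2 ^ i := by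
  obtain ⟨i, m, hm, rfl⟩ := Nat.exists_eq_two_pow_mul_odd he0
  refine ⟨i, ?_⟩
  have hp : C a * (X + C δ) ^ (2 ^ i * m) - C (a * δ ^ (2 ^ i * m)) = C b * X ^ e' := by
    rw [← sub_eq_zero]
    refine Polynomial.eq_zero_of_natDegree_lt_card_of_eval_eq_zero _ Function.injective_id
      (fun x => ?_) ?_
    · simp only [id, eval_sub, eval_mul, eval_pow, eval_add, eval_X, eval_C, h x, sub_self]
    · refine (natDegree_sub_le _ _).trans_lt (max_lt ?_ ?_)
      · rw [natDegree_sub_C]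
        refine (natDegree_C_mul_le _ _).trans_lt ?_
        rwa [natDegree_pow, natDegree_X_add_C, mul_one]
      · exact (natDegree_C_mul_X_pow_le _ _).trans_lt he'
  have hexp : (X + C δ) ^ (2 ^ i * m) = expand F (2 ^ i) ((X + C (δ ^ 2 ^ i)) ^ m) := by
    rw [pow_mul, add_pow_char_pow, map_pow, map_add, expand_X, expand_C, ← C_pow]
  have hc := congrArg (fun p => p.coeff (2 ^ i)) hp
  have h2 : 0 < 2 ^ i := by positivity
  simp only [hexp, coeff_sub, coeff_C_mul, coeff_C, h2.ne', if_false, sub_zero, coeff_X_pow] at hc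
  have hcoef : (expand F (2 ^ i) ((X + C (δ ^ 2 ^ i)) ^ m)).coeff (2 ^ i) =
      (δ ^ 2 ^ i) ^ (m - 1) := by
    have := coeff_expand_mul h2 ((X + C (δ ^ 2 ^ i)) ^ m) 1
    rw [one_mul] at this
    rw [this, coeff_X_add_C_pow, Nat.choose_one_right]
    obtain ⟨n, rfl⟩ := hm
    push_cast
    rw [CharTwo.two_eq_zero (R := F)]; ring
  rw [hcoef] at hc
  by_contra hne
  rw [if_neg (Ne.symm hne), mul_zero] at hc
  exact mul_ne_zero ha (pow_ne_zero _ (pow_ne_zero _ hδ)) hc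

lemma IsOvalFun.translate {f : F → F} (hf : IsOvalFun f) (u v : F) :
    IsOvalFun fun x => f (x + u) - v := by
  refine ⟨fun x y h => ?_, fun x y z hxy hxz hyz h => ?_⟩
  · exact add_right_cancel (hf.inj (sub_left_injective h))
  · refine hf.det3_ne (x + u) (y + u) (z + u) (by simpa) (by simpa) (by simpa) ?_
    simp only [det3] at h ⊢
    linear_combination h

open Classical in
/-- A large affine arc all of whose inversions are affine arcs is contained in the translate of the
graph of a monomial whose exponent is a power of two. -/
lemma IsAffArc.exists_eq_mul_two_pow [Fintype F] [CharP F 2] {S : Finset (F × F)} {t : ℕ}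
    (hS : IsAffArc S) (hSinv : ∀ c ∈ S, IsAffArc (S.image (invAt c)))
    (ht : S.card + t = Fintype.card F) (htq : (t + 1) * (t + 1) ≤ Fintype.card F)
    (h4 : 4 ≤ Fintype.card F) (hS2 : 1 < S.card) {c : F × F} (hc : c ∈ S) :
    ∃ γ : F, ∃ i : ℕ, γ ≠ 0 ∧ ∀ p ∈ S, p.2 - c.2 = γ * (p.1 - c.1) ^ 2 ^ i := by
  obtain ⟨f, hf, hfS⟩ := hS.exists_isOvalFun t ht (by nlinarith)
  have hex : ∀ c ∈ S, ∃ g : F → F, IsOvalFun g ∧ ∀ p ∈ S, g (p.1 - c.1)⁻¹ = (p.2 - c.2)⁻¹ := by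
    intro c hc
    obtain ⟨g, hg, hgS⟩ := (hSinv c hc).exists_isOvalFun t
      (by rw [Finset.card_image_of_injective _ (invAt_injective c), ht]) (by nlinarith)
    exact ⟨g, hg, fun p hp => hgS _ (Finset.mem_image_of_mem _ hp)⟩
  choose! g hg hgS using hex
  obtain ⟨N, hN⟩ : 2 ∣ Fintype.card F := (CharP.cast_eq_zero_iff F 2 _).mp
    (FiniteField.cast_card_eq_zero F)
  have hmono : ∀ c ∈ S, ∃ γ : F, ∃ e : ℕ, γ ≠ 0 ∧ e < Fintype.card F ∧ e ≠ 0 ∧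
      ∀ x, f (x + c.1) - c.2 = γ * x ^ e := by
    intro c hc
    obtain ⟨γ, e, hγ, he, h⟩ := (hf.translate c.1 c.2).exists_eq_mul_pow (hg c hc)
      (by simp [hfS c hc]) (fun x => by
        have := invAt_eq_of_isOvalFun hS hSinv ht htq hf hfS hg hgS hc (x + c.1)
        rwa [add_sub_cancel_right] at this) (N := N) (by omega) hN
    refine ⟨γ, e, hγ, he, ?_, h⟩
    rintro rfl
    have h0 := h 0
    have h1 := h 1
    exact zero_ne_one ((hf.translate c.1 c.2).inj (h0.trans (by rw [h1]; simp)))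
  obtain ⟨d, hd, hdc⟩ := Finset.exists_mem_ne hS2 c
  obtain ⟨γ, e, hγ, he, he0, h⟩ := hmono c hc
  obtain ⟨γ', e', hγ', he', he0', h'⟩ := hmono d hd
  obtain ⟨i, rfl⟩ := exists_eq_two_pow (a := γ') (b := γ) (δ := c.1 - d.1) hγ'
    (sub_ne_zero.mpr (hS.fst_ne c hc d hd hdc.symm)) he' he he0' (fun x => by
      rw [← h', ← h', ← h, sub_add_cancel, ← add_sub_assoc, sub_add_cancel, hfS c hc]
      ring)
  refine ⟨γ, i, hγ, fun p hp => ?_⟩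
  rw [← h, sub_add_cancel, hfS p hp]

end Monomial

section VectorArc

variable {F : Type*} [Field F]

/-- `f` is a linear form on `F³`. -/
def IsLinFun (f : F × F × F → F) : Prop := ∃ l, ∀ v, f v = linForm l v

/-- `Q` is a quadratic form on `F³`. -/
def IsQuadFun (Q : F × F × F → F) : Prop :=
  ∃ a b c d e f : F, ∀ v, Q v = a * v.1 ^ 2 + b * v.2.1 ^ 2 + c * v.2.2 ^ 2 + d * (v.1 * v.2.1) +
    e * (v.1 * v.2.2) + f * (v.2.1 * v.2.2)

/-- A set of vectors of `F³`, no three linearly dependent and no six on a conic. -/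
structure IsVecGenArc (T : Finset (F × F × F)) : Prop where
  bracket_ne : ∀ x ∈ T, ∀ y ∈ T, ∀ z ∈ T, x ≠ y → x ≠ z → y ≠ z → bracket x y z ≠ 0
  card_le : ∀ Q, IsQuadFun Q → (∃ v, Q v ≠ 0) → ∀ s ⊆ T, (∀ x ∈ s, Q x = 0) → s.card ≤ 5

lemma isLinFun_bracket (x y : F × F × F) : IsLinFun fun v => bracket x y v :=
  ⟨(x.2.1 * y.2.2 - x.2.2 * y.2.1, x.2.2 * y.1 - x.1 * y.2.2, x.1 * y.2.1 - x.2.1 * y.1),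
    fun v => by simp only [bracket, linForm]; ring⟩

lemma IsLinFun.add {f g : F × F × F → F} (hf : IsLinFun f) (hg : IsLinFun g) :
    IsLinFun fun v => f v + g v := by
  obtain ⟨l, hl⟩ := hf
  obtain ⟨m, hm⟩ := hg
  exact ⟨l + m, fun v => by
    simp only [hl, hm, linForm, Prod.fst_add, Prod.snd_add]; ring⟩

lemma IsLinFun.const_mul {f : F × F × F → F} (hf : IsLinFun f) (a : F) :
    IsLinFun fun v => a * f v := by
  obtain ⟨l, hl⟩ := hf
  exact ⟨a • l, fun v => by
    simp only [hl, linForm, Prod.smul_fst, Prod.smul_snd, smul_eq_mul]; ring⟩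

lemma IsLinFun.mul {f g : F × F × F → F} (hf : IsLinFun f) (hg : IsLinFun g) :
    IsQuadFun fun v => f v * g v := by
  obtain ⟨l, hl⟩ := hf
  obtain ⟨m, hm⟩ := hg
  refine ⟨l.1 * m.1, l.2.1 * m.2.1, l.2.2 * m.2.2, l.1 * m.2.1 + l.2.1 * m.1,
    l.1 * m.2.2 + l.2.2 * m.1, l.2.1 * m.2.2 + l.2.2 * m.2.1, fun v => ?_⟩
  simp only [hl, hm, linForm]; ring

lemma IsQuadFun.add {f g : F × F × F → F} (hf : IsQuadFun f) (hg : IsQuadFun g) :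
    IsQuadFun fun v => f v + g v := by
  obtain ⟨a, b, c, d, e, k, h⟩ := hf
  obtain ⟨a', b', c', d', e', k', h'⟩ := hg
  exact ⟨a + a', b + b', c + c', d + d', e + e', k + k', fun v => by simp only [h, h']; ring⟩

/-- The affine coordinates of a vector with respect to the triangle `a`, `b`, `c`, the line through
`b` and `c` being at infinity. -/
def affCoord (a b c p : F × F × F) : F × F :=
  (bracket c a p / bracket b c p, bracket a b p / bracket b c p)

lemma det3_affCoord (a b c : F × F × F) {p r s : F × F × F} (hp : bracket b c p ≠ 0)
    (hr : bracket b c r ≠ 0) (hs : bracket b c s ≠ 0) :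
    det3 (affCoord a b c p) (affCoord a b c r) (affCoord a b c s) *
      (bracket b c p * bracket b c r * bracket b c s) = bracket a b c ^ 2 * bracket p r s := by
  have h : det3 (affCoord a b c p) (affCoord a b c r) (affCoord a b c s) *
      (bracket b c p * bracket b c r * bracket b c s) =
      bracket (bracket b c p, bracket c a p, bracket a b p)
        (bracket b c r, bracket c a r, bracket a b r)
        (bracket b c s, bracket c a s, bracket a b s) := by
    simp only [det3, affCoord]
    field_simp
    simp only [bracket.eq_1 (_, _, _) (_, _, _) (_, _, _)]
    ring
  rw [h]
  simp only [bracket]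
  ring

variable {T : Finset (F × F × F)} {a b c : F × F × F}

lemma IsVecGenArc.fst_affCoord_ne (hT : IsVecGenArc T) (ha : a ∈ T) (hb : b ∈ T) (hc : c ∈ T)
    (hab : a ≠ b) (hac : a ≠ c) (hbc : b ≠ c) {p r : F × F × F} (hp : p ∈ T) (hpb : p ≠ b)
    (hpc : p ≠ c) (hr : r ∈ T) (hrb : r ≠ b) (hrc : r ≠ c) (hpr : p ≠ r) :
    (affCoord a b c p).1 ≠ (affCoord a b c r).1 := by
  have h1 := hT.bracket_ne b hb c hc p hp hbc hpb.symm hpc.symm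
  have h2 := hT.bracket_ne b hb c hc r hr hbc hrb.symm hrc.symm
  intro h
  simp only [affCoord] at h
  rw [div_eq_div_iff h1 h2] at h
  refine mul_ne_zero (hT.bracket_ne a ha b hb c hc hab hac hbc)
    (hT.bracket_ne p hp r hr c hc hpr hpc hrc) ?_
  simp only [bracket] at h ⊢
  linear_combination -h

lemma IsVecGenArc.snd_affCoord_ne (hT : IsVecGenArc T) (ha : a ∈ T) (hb : b ∈ T) (hc : c ∈ T)
    (hab : a ≠ b) (hac : a ≠ c) (hbc : b ≠ c) {p r : F × F × F} (hp : p ∈ T) (hpb : p ≠ b)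
    (hpc : p ≠ c) (hr : r ∈ T) (hrb : r ≠ b) (hrc : r ≠ c) (hpr : p ≠ r) :
    (affCoord a b c p).2 ≠ (affCoord a b c r).2 := by
  have h1 := hT.bracket_ne b hb c hc p hp hbc hpb.symm hpc.symm
  have h2 := hT.bracket_ne b hb c hc r hr hbc hrb.symm hrc.symm
  intro h
  simp only [affCoord] at h
  rw [div_eq_div_iff h1 h2] at h
  refine mul_ne_zero (hT.bracket_ne a ha b hb c hc hab hac hbc)
    (hT.bracket_ne p hp r hr b hb hpr hpb hrb) ?_
  simp only [bracket] at h ⊢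
  linear_combination h

open Classical in
lemma IsVecGenArc.isAffArc (hT : IsVecGenArc T) (ha : a ∈ T) (hb : b ∈ T) (hc : c ∈ T)
    (hab : a ≠ b) (hac : a ≠ c) (hbc : b ≠ c) :
    IsAffArc (((T.erase b).erase c).image (affCoord a b c)) := by
  refine ⟨?_, ?_, ?_⟩
  · intro x hx y hy hxy
    obtain ⟨p, hp, rfl⟩ := Finset.mem_image.mp hx
    obtain ⟨r, hr, rfl⟩ := Finset.mem_image.mp hy
    simp only [Finset.mem_erase] at hp hr
    exact hT.fst_affCoord_ne ha hb hc hab hac hbc hp.2.2 hp.2.1 hp.1 hr.2.2 hr.2.1 hr.1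
      (by rintro rfl; exact hxy rfl)
  · intro x hx y hy hxy
    obtain ⟨p, hp, rfl⟩ := Finset.mem_image.mp hx
    obtain ⟨r, hr, rfl⟩ := Finset.mem_image.mp hy
    simp only [Finset.mem_erase] at hp hr
    exact hT.snd_affCoord_ne ha hb hc hab hac hbc hp.2.2 hp.2.1 hp.1 hr.2.2 hr.2.1 hr.1
      (by rintro rfl; exact hxy rfl)
  · intro x hx y hy z hz hxy hxz hyz h
    obtain ⟨p, hp, rfl⟩ := Finset.mem_image.mp hx
    obtain ⟨r, hr, rfl⟩ := Finset.mem_image.mp hy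
    obtain ⟨s, hs, rfl⟩ := Finset.mem_image.mp hz
    simp only [Finset.mem_erase] at hp hr hs
    have key := det3_affCoord a b c
      (hT.bracket_ne b hb c hc p hp.2.2 hbc hp.2.1.symm hp.1.symm)
      (hT.bracket_ne b hb c hc r hr.2.2 hbc hr.2.1.symm hr.1.symm)
      (hT.bracket_ne b hb c hc s hs.2.2 hbc hs.2.1.symm hs.1.symm)
    rw [h, zero_mul, eq_comm] at key
    refine mul_ne_zero (pow_ne_zero 2 (hT.bracket_ne a ha b hb c hc hab hac hbc)) ?_ key
    exact hT.bracket_ne p hp.2.2 r hr.2.2 s hs.2.2 (by rintro rfl; exact hxy rfl)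
      (by rintro rfl; exact hxz rfl) (by rintro rfl; exact hyz rfl)

/-- Five points of a generalized arc together with a further one do not lie on a hyperbola. -/
lemma IsVecGenArc.det3_invAt_ne (hT : IsVecGenArc T) (ha : a ∈ T) (hb : b ∈ T) (hc : c ∈ T)
    (hab : a ≠ b) (hac : a ≠ c) (hbc : b ≠ c) {d p r s : F × F × F}
    (hd : d ∈ T) (hdb : d ≠ b) (hdc : d ≠ c) (hp : p ∈ T) (hpb : p ≠ b) (hpc : p ≠ c)
    (hr : r ∈ T) (hrb : r ≠ b) (hrc : r ≠ c) (hs : s ∈ T) (hsb : s ≠ b) (hsc : s ≠ c)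
    (hdp : d ≠ p) (hdr : d ≠ r) (hds : d ≠ s) (hpr : p ≠ r) (hps : p ≠ s) (hrs : r ≠ s) :
    det3 (invAt (affCoord a b c d) (affCoord a b c p)) (invAt (affCoord a b c d) (affCoord a b c r))
      (invAt (affCoord a b c d) (affCoord a b c s)) ≠ 0 := by
  classical
  intro h
  have hD := hT.bracket_ne a ha b hb c hc hab hac hbc
  have hx : ∀ e ∈ T, e ≠ b → e ≠ c → d ≠ e → (affCoord a b c e).1 - (affCoord a b c d).1 ≠ 0 :=
    fun e he heb hec hde => sub_ne_zero.mpr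
      (hT.fst_affCoord_ne ha hb hc hab hac hbc he heb hec hd hdb hdc hde.symm)
  have hy : ∀ e ∈ T, e ≠ b → e ≠ c → d ≠ e → (affCoord a b c e).2 - (affCoord a b c d).2 ≠ 0 :=
    fun e he heb hec hde => sub_ne_zero.mpr
      (hT.snd_affCoord_ne ha hb hc hab hac hbc he heb hec hd hdb hdc hde.symm)
  set u := (affCoord a b c d).1 with hu
  set v := (affCoord a b c d).2 with hv
  set P := invAt (affCoord a b c d) (affCoord a b c p) with hP
  set R := invAt (affCoord a b c d) (affCoord a b c r) with hR
  set A := (R.2 - P.2) * P.1 - (R.1 - P.1) * P.2 with hA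
  set B := P.2 - R.2 with hB
  set E := R.1 - P.1 with hE
  have hE0 : E ≠ 0 := by
    simp only [hE, hR, hP, invAt, ne_eq, sub_eq_zero, inv_inj, sub_left_inj]
    exact (hT.fst_affCoord_ne ha hb hc hab hac hbc hp hpb hpc hr hrb hrc hpr).symm
  have hquad : IsQuadFun fun w =>
      (A * (bracket c a w + -u * bracket b c w) + B * bracket b c w) *
        (bracket a b w + -v * bracket b c w) +
      (E * bracket b c w) * (bracket c a w + -u * bracket b c w) := by
    have h1 := isLinFun_bracket b c
    have h2 := (isLinFun_bracket c a).add (h1.const_mul (-u))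
    have h3 := (isLinFun_bracket a b).add (h1.const_mul (-v))
    exact (((h2.const_mul A).add (h1.const_mul B)).mul h3).add ((h1.const_mul E).mul h2)
  have hval : ∀ e ∈ T, e ≠ b → e ≠ c → d ≠ e →
      A + B * (invAt (affCoord a b c d) (affCoord a b c e)).1 +
        E * (invAt (affCoord a b c d) (affCoord a b c e)).2 = 0 →
      (A * (bracket c a e + -u * bracket b c e) + B * bracket b c e) *
        (bracket a b e + -v * bracket b c e) +
      (E * bracket b c e) * (bracket c a e + -u * bracket b c e) = 0 := by
    intro e he heb hec hde h0
    have h1 := hT.bracket_ne b hb c hc e he hbc heb.symm hec.symm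
    have h2 := hx e he heb hec hde
    have h3 := hy e he heb hec hde
    have h4 : bracket c a e = (affCoord a b c e).1 * bracket b c e := by
      simp only [affCoord]; field_simp
    have h5 : bracket a b e = (affCoord a b c e).2 * bracket b c e := by
      simp only [affCoord]; field_simp
    simp only [invAt, ← hu, ← hv] at h0
    rw [h4, h5]
    field_simp at h0
    linear_combination (bracket b c e) ^ 2 * h0
  have hcard := hT.card_le _ hquad ⟨(a.1 + (u + 1) * b.1 + v * c.1,
    a.2.1 + (u + 1) * b.2.1 + v * c.2.1, a.2.2 + (u + 1) * b.2.2 + v * c.2.2), ?_⟩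
    {d, p, r, s, b, c} ?_ ?_
  · have : ({d, p, r, s, b, c} : Finset (F × F × F)).card = 6 := by
      rw [Finset.card_insert_of_notMem, Finset.card_insert_of_notMem, Finset.card_insert_of_notMem,
        Finset.card_insert_of_notMem, Finset.card_pair hbc]
      all_goals simp_all
    omega
  · have h1 : ∀ w, w = (a.1 + (u + 1) * b.1 + v * c.1,
        a.2.1 + (u + 1) * b.2.1 + v * c.2.1, a.2.2 + (u + 1) * b.2.2 + v * c.2.2) →
        bracket b c w = bracket a b c ∧ bracket c a w = (u + 1) * bracket a b c ∧
        bracket a b w = v * bracket a b c := by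
      rintro w rfl
      refine ⟨?_, ?_, ?_⟩ <;> simp only [bracket] <;> ring
    obtain ⟨e1, e2, e3⟩ := h1 _ rfl
    rw [e1, e2, e3]
    have : (A * ((u + 1) * bracket a b c + -u * bracket a b c) + B * bracket a b c) *
        (v * bracket a b c + -v * bracket a b c) +
        E * bracket a b c * ((u + 1) * bracket a b c + -u * bracket a b c) =
        E * bracket a b c * bracket a b c := by ring
    rw [this]
    exact mul_ne_zero (mul_ne_zero hE0 hD) hD
  · intro x hx
    simp only [Finset.mem_insert, Finset.mem_singleton] at hx
    rcases hx with rfl | rfl | rfl | rfl | rfl | rfl <;> assumption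
  · intro x hx'
    simp only [Finset.mem_insert, Finset.mem_singleton] at hx'
    have hbb : ∀ x y : F × F × F, bracket x y x = 0 := fun x y => by simp only [bracket]; ring
    rcases hx' with e | e | e | e | e | e
    · rw [e]
      have h1 := hT.bracket_ne b hb c hc d hd hbc hdb.symm hdc.symm
      have h2 : bracket c a d + -u * bracket b c d = 0 := by
        simp only [hu, affCoord]; field_simp; ring
      have h3 : bracket a b d + -v * bracket b c d = 0 := by
        simp only [hv, affCoord]; field_simp; ring
      rw [h2, h3]; ring
    · rw [e]
      refine hval p hp hpb hpc hdp ?_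
      rw [← hP]; simp only [hA, hB, hE]; ring
    · rw [e]
      refine hval r hr hrb hrc hdr ?_
      rw [← hR]; simp only [hA, hB, hE]; ring
    · rw [e]
      refine hval s hs hsb hsc hds ?_
      simp only [hA, hB, hE]
      simp only [det3] at h
      linear_combination h
    · rw [e, bracket_self_right, hbb]; ring
    · rw [e, bracket_self_right, hbb]; ring

open Classical in
lemma IsVecGenArc.isAffArc_invAt (hT : IsVecGenArc T) (ha : a ∈ T) (hb : b ∈ T) (hc : c ∈ T)
    (hab : a ≠ b) (hac : a ≠ c) (hbc : b ≠ c) :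
    ∀ d ∈ ((T.erase b).erase c).image (affCoord a b c),
      IsAffArc ((((T.erase b).erase c).image (affCoord a b c)).image (invAt d)) := by
  have hS := hT.isAffArc ha hb hc hab hac hbc
  intro d hd
  refine ⟨?_, ?_, ?_⟩
  · intro x hx y hy hxy
    obtain ⟨p, hp, rfl⟩ := Finset.mem_image.mp hx
    obtain ⟨r, hr, rfl⟩ := Finset.mem_image.mp hy
    simp only [invAt, ne_eq, inv_inj, sub_left_inj]
    exact hS.fst_ne p hp r hr (by rintro rfl; exact hxy rfl)
  · intro x hx y hy hxy
    obtain ⟨p, hp, rfl⟩ := Finset.mem_image.mp hx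
    obtain ⟨r, hr, rfl⟩ := Finset.mem_image.mp hy
    simp only [invAt, ne_eq, inv_inj, sub_left_inj]
    exact hS.snd_ne p hp r hr (by rintro rfl; exact hxy rfl)
  · have hcentre : ∀ p ∈ ((T.erase b).erase c).image (affCoord a b c),
        ∀ r ∈ ((T.erase b).erase c).image (affCoord a b c), d ≠ p → d ≠ r → p ≠ r →
        det3 (invAt d d) (invAt d p) (invAt d r) ≠ 0 := by
      intro p hp r hr hdp hdr hpr h
      refine hS.det3_ne d hd p hp r hr hdp hdr hpr ?_
      have h1 := sub_ne_zero.mpr (hS.fst_ne p hp d hd hdp.symm)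
      have h2 := sub_ne_zero.mpr (hS.snd_ne p hp d hd hdp.symm)
      have h3 := sub_ne_zero.mpr (hS.fst_ne r hr d hd hdr.symm)
      have h4 := sub_ne_zero.mpr (hS.snd_ne r hr d hd hdr.symm)
      simp only [det3, invAt, sub_self, inv_zero, sub_zero] at h ⊢
      field_simp at h
      linear_combination -h
    intro x hx y hy z hz hxy hxz hyz
    obtain ⟨p, hp, rfl⟩ := Finset.mem_image.mp hx
    obtain ⟨r, hr, rfl⟩ := Finset.mem_image.mp hy
    obtain ⟨s, hs, rfl⟩ := Finset.mem_image.mp hz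
    have hpr : p ≠ r := by rintro rfl; exact hxy rfl
    have hps : p ≠ s := by rintro rfl; exact hxz rfl
    have hrs : r ≠ s := by rintro rfl; exact hyz rfl
    by_cases h1 : d = p
    · subst h1; exact hcentre r hr s hs hpr hps hrs
    by_cases h2 : d = r
    · subst h2
      rw [det3_swap_left]
      exact neg_ne_zero.mpr (hcentre p hp s hs h1 hrs hps)
    by_cases h3 : d = s
    · subst h3
      rw [det3_swap_right, det3_swap_left, neg_neg]
      exact hcentre p hp r hr h1 h2 hpr
    obtain ⟨d, hd', rfl⟩ := Finset.mem_image.mp hd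
    obtain ⟨p, hp', rfl⟩ := Finset.mem_image.mp hp
    obtain ⟨r, hr', rfl⟩ := Finset.mem_image.mp hr
    obtain ⟨s, hs', rfl⟩ := Finset.mem_image.mp hs
    simp only [Finset.mem_erase] at hd' hp' hr' hs'
    exact hT.det3_invAt_ne ha hb hc hab hac hbc hd'.2.2 hd'.2.1 hd'.1 hp'.2.2 hp'.2.1 hp'.1
      hr'.2.2 hr'.2.1 hr'.1 hs'.2.2 hs'.2.1 hs'.1 (by rintro rfl; exact h1 rfl)
      (by rintro rfl; exact h2 rfl) (by rintro rfl; exact h3 rfl) (by rintro rfl; exact hpr rfl)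
      (by rintro rfl; exact hps rfl) (by rintro rfl; exact hrs rfl)

/-- A large generalized arc is contained in a monomial curve in the coordinates given by any three
of its points. -/
lemma IsVecGenArc.exists_eq_mul_two_pow [Fintype F] [CharP F 2] (hT : IsVecGenArc T) (ha : a ∈ T)
    (hb : b ∈ T) (hc : c ∈ T) (hab : a ≠ b) (hac : a ≠ c) (hbc : b ≠ c) {t : ℕ}
    (ht : T.card + t = Fintype.card F + 2) (htq : (t + 1) * (t + 1) ≤ Fintype.card F)
    (h4 : 4 ≤ Fintype.card F) (hT4 : 4 ≤ T.card) :
    ∃ γ : F, ∃ i : ℕ, γ ≠ 0 ∧ ∀ p ∈ T, p ≠ b → p ≠ c →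
      bracket a b p / bracket b c p = γ * (bracket c a p / bracket b c p) ^ 2 ^ i := by
  classical
  have hcard : (((T.erase b).erase c).image (affCoord a b c)).card = T.card - 2 := by
    rw [Finset.card_image_of_injOn, Finset.card_erase_of_mem (Finset.mem_erase.mpr ⟨hbc.symm, hc⟩),
      Finset.card_erase_of_mem hb]
    · omega
    · intro p hp r hr h
      simp only [Finset.coe_erase, Set.mem_sdiff, Finset.mem_coe, Set.mem_singleton_iff] at hp hr
      by_contra hne
      exact hT.fst_affCoord_ne ha hb hc hab hac hbc hp.1.1 hp.1.2 hp.2 hr.1.1 hr.1.2 hr.2 hne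
        (congrArg Prod.fst h)
  have haS : affCoord a b c a = 0 := by
    have h1 : bracket c a a = 0 := bracket_self_right _ _
    have h2 : bracket a b a = 0 := by simp only [bracket]; ring
    simp [affCoord, h1, h2]
  obtain ⟨γ, i, hγ, h⟩ := (hT.isAffArc ha hb hc hab hac hbc).exists_eq_mul_two_pow
    (hT.isAffArc_invAt ha hb hc hab hac hbc) (t := t) (by omega) htq h4 (by omega)
    (Finset.mem_image_of_mem (affCoord a b c)
      (Finset.mem_erase.mpr ⟨hac, Finset.mem_erase.mpr ⟨hab, ha⟩⟩))
  refine ⟨γ, i, hγ, fun p hp hpb hpc => ?_⟩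
  have := h _ (Finset.mem_image_of_mem (affCoord a b c)
    (Finset.mem_erase.mpr ⟨hpc, Finset.mem_erase.mpr ⟨hpb, hp⟩⟩))
  rw [haS] at this
  simpa [affCoord] using this

end VectorArc

section Monomial

variable {F : Type*} [Field F] [Fintype F]

open Classical in
/-- A subset of the multiplicative group with more than half of its elements meets all of its
multiplicative translates. -/
lemma exists_mem_mul_mem {X : Finset F} (hX : ∀ x ∈ X, x ≠ 0) (hcard : Fintype.card F ≤ 2 * X.card)
    {y : F} (hy : y ≠ 0) : ∃ x ∈ X, y * x ∈ X := by
  have h1 : (X.image (y * ·)).card = X.card :=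
    Finset.card_image_of_injective _ (mul_right_injective₀ hy)
  have h2 : (X ∪ X.image (y * ·)).card ≤ Fintype.card F - 1 := by
    rw [← Finset.card_univ, ← Finset.card_erase_of_mem (Finset.mem_univ (0 : F))]
    refine Finset.card_le_card fun x hx => Finset.mem_erase.mpr ⟨?_, Finset.mem_univ _⟩
    rcases Finset.mem_union.mp hx with h | h
    · exact hX x h
    · obtain ⟨z, hz, rfl⟩ := Finset.mem_image.mp h
      exact mul_ne_zero hy (hX z hz)
  have h3 := Finset.card_union_add_card_inter X (X.image (y * ·))
  have h4 : 0 < Fintype.card F := Fintype.card_pos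
  obtain ⟨w, hw⟩ := Finset.card_pos.mp (show 0 < (X ∩ X.image (y * ·)).card by omega)
  rw [Finset.mem_inter, Finset.mem_image] at hw
  obtain ⟨hw, x, hx, rfl⟩ := hw
  exact ⟨x, hx, hw⟩

open Classical in
/-- Two monomial relations between the homogeneous coordinates of many points force an identity
between powers. -/
lemma pow_eq_pow_of_monomial_relations {ι : Type*} {T : Finset ι} {α β γ : ι → F} {C D : F}
    {m n : ℕ} (hα : ∀ p ∈ T, α p ≠ 0) (hβ : ∀ p ∈ T, β p ≠ 0)
    (hinj : ∀ p ∈ T, ∀ r ∈ T, β p / α p = β r / α r → p = r)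
    (hcard : Fintype.card F ≤ 2 * T.card)
    (h1 : ∀ p ∈ T, γ p / α p = C * (β p / α p) ^ m)
    (h2 : ∀ p ∈ T, α p / β p = D * (γ p / β p) ^ n) {y : F} (hy : y ≠ 0) :
    y ^ (m * n + 1) = y ^ n := by
  have hX : ∀ x ∈ T.image fun p => β p / α p, x ≠ 0 := by
    intro x hx
    obtain ⟨p, hp, rfl⟩ := Finset.mem_image.mp hx
    exact div_ne_zero (hβ p hp) (hα p hp)
  have hrel : ∀ x ∈ T.image fun p => β p / α p, D * C ^ n * x ^ (m * n + 1) = x ^ n := by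
    intro x hx
    obtain ⟨p, hp, rfl⟩ := Finset.mem_image.mp hx
    have ha := hα p hp
    have hb := hβ p hp
    have e1 := h2 p hp
    have e2 : γ p / β p = C * (β p / α p) ^ m / (β p / α p) := by
      rw [← h1 p hp]; field_simp
    have e3 : α p / β p = (β p / α p)⁻¹ := by field_simp
    rw [e2, e3] at e1
    have hx0 := hX _ hx
    generalize β p / α p = x at *
    rw [div_pow, mul_pow, ← pow_mul] at e1
    field_simp at e1
    rw [e1]; ring
  obtain ⟨x, hx, hyx⟩ := exists_mem_mul_mem hX
    (by rwa [Finset.card_image_of_injOn fun p hp r hr h => hinj p hp r hr h]) hy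
  have e1 := hrel x hx
  have e2 := hrel _ hyx
  refine mul_right_cancel₀ (pow_ne_zero n (hX x hx)) ?_
  rw [← mul_pow y x n, ← e2, ← e1]
  ring

lemma pow_two_pow_eq_sq {F : Type*} [Field F] [CharP F 2] {i j : ℕ} (h : ∀ y : F, y ≠ 0 → y ^ (2 ^ i * 2 ^ j + 1) = y ^ 2 ^ j)
    (y : F) : y ^ (2 ^ i * 2 ^ j) = y ∧ y ^ 2 ^ j = y ^ 2 := by
  have hall : ∀ y : F, y ^ (2 ^ i * 2 ^ j + 1) = y ^ 2 ^ j := by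
    intro y
    rcases eq_or_ne y 0 with rfl | hy
    · rw [zero_pow (Nat.succ_ne_zero _), zero_pow (by positivity)]
    · exact h y hy
  have e1 := hall y
  have e2 := hall (y + 1)
  rw [pow_succ, ← pow_add, add_pow_char_pow, add_pow_char_pow, one_pow, one_pow] at e2
  rw [pow_succ, ← pow_add] at e1
  have e3 : y ^ 2 ^ (i + j) + y = 0 := by linear_combination e2 - e1
  have e4 : y ^ 2 ^ (i + j) = y := CharTwo.add_eq_zero.mp e3
  rw [← pow_add]
  exact ⟨e4, by rw [← e1, e4]; ring⟩

lemma exists_pow_four_ne (h : 4 < Fintype.card F) : ∃ y : F, y ^ 4 ≠ y := by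
  by_contra! hall
  have hdeg : (Polynomial.X ^ 4 - Polynomial.X : Polynomial F).natDegree = 4 := by
    compute_degree!
  have := Polynomial.eq_zero_of_natDegree_lt_card_of_eval_eq_zero
    (Polynomial.X ^ 4 - Polynomial.X : Polynomial F) (f := id) Function.injective_id
    (fun y => by simp [hall y]) (by rwa [hdeg])
  rw [this] at hdeg
  simp at hdeg

open Classical in
lemma IsVecGenArc.card_le_card_add_two {T : Finset (F × F × F)} (hT : IsVecGenArc T)
    (hT3 : 3 ≤ T.card) : T.card ≤ Fintype.card F + 2 := by
  obtain ⟨a, ha, b, hb, c, hc, hab, hac, hbc⟩ := Finset.two_lt_card.mp hT3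
  have h1 : ((T.erase b).erase c).card = T.card - 2 := by
    rw [Finset.card_erase_of_mem (Finset.mem_erase.mpr ⟨hbc.symm, hc⟩),
      Finset.card_erase_of_mem hb]
    omega
  have h2 := Finset.card_le_card_of_injOn (s := (T.erase b).erase c) (t := Finset.univ)
    (fun p => (affCoord a b c p).1) (fun _ _ => Finset.mem_coe.mpr (Finset.mem_univ _)) (by
      intro p hp r hr h
      simp only [Finset.coe_erase, Set.mem_sdiff, Finset.mem_coe, Set.mem_singleton_iff] at hp hr
      by_contra hne
      exact hT.fst_affCoord_ne ha hb hc hab hac hbc hp.1.1 hp.1.2 hp.2 hr.1.1 hr.1.2 hr.2 hne h)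
  rw [Finset.card_univ] at h2
  omega

open Classical in
/-- In even characteristic there are no generalized arcs with small deficiency. -/
lemma IsVecGenArc.card_lt_sq [CharP F 2] {T : Finset (F × F × F)} (hT : IsVecGenArc T)
    {t : ℕ} (ht : T.card + t = Fintype.card F + 2) (h16 : 16 ≤ Fintype.card F) :
    Fintype.card F < (t + 1) * (t + 1) := by
  by_contra! htq
  have ht2 : 2 * t + 2 ≤ Fintype.card F := by
    rcases Nat.eq_zero_or_pos t with rfl | h
    · omega
    · nlinarith
  obtain ⟨a, ha, b, hb, c, hc, hab, hac, hbc⟩ :=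
    Finset.two_lt_card.mp (show 2 < T.card by omega)
  obtain ⟨C₁, i, -, h1⟩ := hT.exists_eq_mul_two_pow ha hb hc hab hac hbc ht htq (by omega)
    (by omega)
  obtain ⟨C₂, j, -, h2⟩ := hT.exists_eq_mul_two_pow hb hc ha hbc hab.symm hac.symm ht htq
    (by omega) (by omega)
  obtain ⟨C₃, k, -, h3⟩ := hT.exists_eq_mul_two_pow hc ha hb hac.symm hbc.symm hab ht htq
    (by omega) (by omega)
  have hmem : ∀ p ∈ ((T.erase a).erase b).erase c, p ∈ T ∧ p ≠ a ∧ p ≠ b ∧ p ≠ c := by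
    intro p hp
    simp only [Finset.mem_erase] at hp
    tauto
  have hcard : Fintype.card F ≤ 2 * (((T.erase a).erase b).erase c).card := by
    rw [Finset.card_erase_of_mem, Finset.card_erase_of_mem, Finset.card_erase_of_mem ha]
    · omega
    · exact Finset.mem_erase.mpr ⟨hab.symm, hb⟩
    · exact Finset.mem_erase.mpr ⟨hbc.symm, Finset.mem_erase.mpr ⟨hac.symm, hc⟩⟩
  have hα : ∀ p ∈ ((T.erase a).erase b).erase c, bracket b c p ≠ 0 := fun p hp =>
    have ⟨hpT, _, hpb, hpc⟩ := hmem p hp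
    hT.bracket_ne b hb c hc p hpT hbc hpb.symm hpc.symm
  have hβ : ∀ p ∈ ((T.erase a).erase b).erase c, bracket c a p ≠ 0 := fun p hp =>
    have ⟨hpT, hpa, _, hpc⟩ := hmem p hp
    hT.bracket_ne c hc a ha p hpT hac.symm hpc.symm hpa.symm
  have hγ : ∀ p ∈ ((T.erase a).erase b).erase c, bracket a b p ≠ 0 := fun p hp =>
    have ⟨hpT, hpa, hpb, _⟩ := hmem p hp
    hT.bracket_ne a ha b hb p hpT hab hpa.symm hpb.symm
  have r1 := fun y : F => pow_eq_pow_of_monomial_relations (y := y) hα hβ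
    (fun p hp r hr h => by
      by_contra hne
      have ⟨hpT, _, hpb, hpc⟩ := hmem p hp
      have ⟨hrT, _, hrb, hrc⟩ := hmem r hr
      exact hT.fst_affCoord_ne ha hb hc hab hac hbc hpT hpb hpc hrT hrb hrc hne h)
    hcard (fun p hp => have ⟨hpT, _, hpb, hpc⟩ := hmem p hp; h1 p hpT hpb hpc)
    (fun p hp => have ⟨hpT, hpa, _, hpc⟩ := hmem p hp; h2 p hpT hpc hpa)
  have r2 := fun y : F => pow_eq_pow_of_monomial_relations (y := y) hγ hα
    (fun p hp r hr h => by
      by_contra hne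
      have ⟨hpT, hpa, hpb, _⟩ := hmem p hp
      have ⟨hrT, hra, hrb, _⟩ := hmem r hr
      exact hT.fst_affCoord_ne hc ha hb hac.symm hbc.symm hab hpT hpa hpb hrT hra hrb hne h)
    hcard (fun p hp => have ⟨hpT, hpa, hpb, _⟩ := hmem p hp; h3 p hpT hpa hpb)
    (fun p hp => have ⟨hpT, _, hpb, hpc⟩ := hmem p hp; h1 p hpT hpb hpc)
  obtain ⟨y, hy⟩ := exists_pow_four_ne (show 4 < Fintype.card F by omega)
  refine hy ?_
  have e1 := (pow_two_pow_eq_sq r1 y).1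
  rw [pow_mul, (pow_two_pow_eq_sq r2 y).2, (pow_two_pow_eq_sq r1 _).2, ← pow_mul] at e1
  exact e1

end Monomial

section Projective

variable {F : Type*} [Field F]

/-- A representative of a point of the projective plane, as a triple. -/
noncomputable def P2.vec (p : P2 F) : F × F × F := (p.rep 0, p.rep 1, p.rep 2)

lemma P2.vec_injective : Function.Injective (P2.vec : P2 F → F × F × F) := by
  intro p r h
  have h' : p.rep = r.rep := by
    simp only [P2.vec, Prod.mk.injEq] at h
    ext i
    fin_cases i
    · exact h.1
    · exact h.2.1
    · exact h.2.2
  rw [← p.mk_rep, ← r.mk_rep]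
  simp only [h']

lemma P2.exists_bracket_vec_ne {p r : P2 F} (h : p ≠ r) : ∃ v, bracket p.vec r.vec v ≠ 0 := by
  rw [← Projectivization.independent_pair_iff_ne, Projectivization.independent_iff] at h
  have hrep : Projectivization.rep ∘ ![p, r] = ![p.rep, r.rep] := by
    ext i : 1
    fin_cases i <;> rfl
  rw [hrep, ← crossProduct_ne_zero_iff_linearIndependent] at h
  by_contra! hall
  refine h ?_
  have e0 := hall (1, 0, 0)
  have e1 := hall (0, 1, 0)
  have e2 := hall (0, 0, 1)
  simp only [bracket, P2.vec] at e0 e1 e2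
  rw [cross_apply]
  ext i
  fin_cases i
  · simpa using (by linear_combination e0 : p.rep 1 * r.rep 2 - p.rep 2 * r.rep 1 = 0)
  · simpa using (by linear_combination e1 : p.rep 2 * r.rep 0 - p.rep 0 * r.rep 2 = 0)
  · simpa using (by linear_combination e2 : p.rep 0 * r.rep 1 - p.rep 1 * r.rep 0 = 0)

lemma IsLinFun.exists_mul_ne {f g : F × F × F → F} (hf : IsLinFun f) (hg : IsLinFun g)
    (hf0 : ∃ v, f v ≠ 0) (hg0 : ∃ v, g v ≠ 0) : ∃ v, f v * g v ≠ 0 := by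
  obtain ⟨v, hv⟩ := hf0
  obtain ⟨w, hw⟩ := hg0
  by_contra! hall
  obtain ⟨l, hl⟩ := hf
  obtain ⟨m, hm⟩ := hg
  have e1 : g v = 0 := (mul_eq_zero.mp (hall v)).resolve_left hv
  have e2 : f w = 0 := (mul_eq_zero.mp (hall w)).resolve_right hw
  have e3 : f (v + w) = f v + f w := by simp only [hl, linForm, Prod.fst_add, Prod.snd_add]; ring
  have e4 : g (v + w) = g v + g w := by simp only [hm, linForm, Prod.fst_add, Prod.snd_add]; ring
  have e5 := hall (v + w)
  rw [e3, e4, e1, e2, add_zero, zero_add] at e5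
  exact mul_ne_zero hv hw e5

open MvPolynomial in
lemma IsGenArc.card_le_five [Finite F] {K : Set (P2 F)} (hK : IsGenArc K) {Q : F × F × F → F}
    (hQ : IsQuadFun Q) (hQ0 : ∃ v, Q v ≠ 0) {s : Finset (P2 F)} (hs : ∀ p ∈ s, p ∈ K)
    (hzero : ∀ p ∈ s, Q p.vec = 0) : s.card ≤ 5 := by
  obtain ⟨a, b, c, d, e, f, h⟩ := hQ
  obtain ⟨v, hv⟩ := hQ0
  set R : MvPolynomial (Fin 3) F := C a * X 0 ^ 2 + C b * X 1 ^ 2 + C c * X 2 ^ 2 +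
    C d * (X 0 * X 1) + C e * (X 0 * X 2) + C f * (X 1 * X 2) with hR
  have heval : ∀ x : Fin 3 → F, eval x R = Q (x 0, x 1, x 2) := by
    intro x
    simp [hR, h]
  have hhom : R.IsHomogeneous 2 := by
    have hXX : ∀ i j : Fin 3, (X i * X j : MvPolynomial (Fin 3) F).IsHomogeneous 2 :=
      fun i j => (isHomogeneous_X F i).mul (isHomogeneous_X F j)
    exact (((((isHomogeneous_X_pow 0 2).C_mul a).add ((isHomogeneous_X_pow 1 2).C_mul b)).add
      ((isHomogeneous_X_pow 2 2).C_mul c)).add ((hXX 0 1).C_mul d)).add ((hXX 0 2).C_mul e)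
        |>.add ((hXX 1 2).C_mul f)
  have hR0 : R ≠ 0 := by
    intro h0
    have := heval ![v.1, v.2.1, v.2.2]
    rw [h0, map_zero] at this
    exact hv this.symm
  have h5 := hK {p | eval p.rep R = 0} ⟨R, hR0, hhom, rfl⟩
  rw [← Set.ncard_coe_finset]
  refine (Set.ncard_le_ncard ?_ (Set.toFinite _)).trans h5
  intro p hp
  refine ⟨hs p hp, ?_⟩
  rw [Set.mem_ofPred_eq, heval]
  exact hzero p hp

open Classical in
/-- A generalized arc contains an arc that misses at most three of its points. -/
lemma IsGenArc.exists_isVecGenArc [Finite F] {K : Set (P2 F)} (hK : IsGenArc K) :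
    ∃ T : Finset (F × F × F), IsVecGenArc T ∧ K.ncard ≤ T.card + 3 := by
  obtain ⟨S, rfl⟩ : ∃ S : Finset (P2 F), K = S := ⟨K.toFinite.toFinset, by simp⟩
  rw [Set.ncard_coe_finset]
  have hsub : ∀ U ⊆ S, (∀ x ∈ U, ∀ y ∈ U, ∀ z ∈ U, x ≠ y → x ≠ z → y ≠ z →
      bracket x.vec y.vec z.vec ≠ 0) → IsVecGenArc (U.image P2.vec) := by
    intro U hU hne
    refine ⟨?_, ?_⟩
    · intro x hx y hy z hz hxy hxz hyz
      obtain ⟨p, hp, rfl⟩ := Finset.mem_image.mp hx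
      obtain ⟨r, hr, rfl⟩ := Finset.mem_image.mp hy
      obtain ⟨s, hs, rfl⟩ := Finset.mem_image.mp hz
      exact hne p hp r hr s hs (ne_of_apply_ne _ hxy) (ne_of_apply_ne _ hxz)
        (ne_of_apply_ne _ hyz)
    · intro Q hQ hQ0 s hs hzero
      obtain ⟨V, hV, rfl⟩ := Finset.subset_image_iff.mp hs
      rw [Finset.card_image_of_injective _ P2.vec_injective]
      exact hK.card_le_five hQ hQ0 (fun p hp => hU (hV hp))
        fun p hp => hzero _ (Finset.mem_image_of_mem _ hp)
  by_cases hline : ∃ x ∈ S, ∃ y ∈ S, ∃ z ∈ S, x ≠ y ∧ x ≠ z ∧ y ≠ z ∧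
      bracket x.vec y.vec z.vec = 0
  · obtain ⟨x, hx, y, hy, z, hz, hxy, hxz, hyz, h0⟩ := hline
    refine ⟨_, hsub (S \ {x, y, z}) Finset.sdiff_subset ?_, ?_⟩
    · intro p hp r hr s hs hpr hps hrs h0'
      simp only [Finset.mem_sdiff, Finset.mem_insert, Finset.mem_singleton, not_or] at hp hr hs
      have h5 := hK.card_le_five (s := {x, y, z, p, r, s})
        ((isLinFun_bracket x.vec y.vec).mul (isLinFun_bracket p.vec r.vec))
        ((isLinFun_bracket x.vec y.vec).exists_mul_ne (isLinFun_bracket p.vec r.vec)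
          (P2.exists_bracket_vec_ne hxy) (P2.exists_bracket_vec_ne hpr)) (by
            intro w hw
            simp only [Finset.mem_insert, Finset.mem_singleton] at hw
            rcases hw with rfl | rfl | rfl | rfl | rfl | rfl
            exacts [hx, hy, hz, hp.1, hr.1, hs.1]) (by
            have hb : ∀ u v : F × F × F, bracket u v u = 0 := fun u v => by
              simp only [bracket]; ring
            intro w hw
            simp only [Finset.mem_insert, Finset.mem_singleton] at hw
            rcases hw with rfl | rfl | rfl | rfl | rfl | rfl <;>
              simp [hb, bracket_self_right, h0, h0'])
      have h6 : ({x, y, z, p, r, s} : Finset (P2 F)).card = 6 := by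
        rw [Finset.card_insert_of_notMem, Finset.card_insert_of_notMem,
          Finset.card_insert_of_notMem, Finset.card_insert_of_notMem, Finset.card_pair hrs]
        all_goals
          simp only [Finset.mem_insert, Finset.mem_singleton]
          tauto
      omega
    · rw [Finset.card_image_of_injective _ P2.vec_injective]
      have h1 := Finset.le_card_sdiff {x, y, z} S
      have h2 := Finset.card_le_three (a := x) (b := y) (c := z)
      omega
  · push Not at hline
    refine ⟨_, hsub S subset_rfl fun x hx y hy z hz => hline x hx y hy z hz, ?_⟩
    rw [Finset.card_image_of_injective _ P2.vec_injective]
    omega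

end Projective

/-- for `q ≥ 16` even, every generalized `k`-arc in `P²(F)` satisfies
`k ≤ q − √q/2 + 17/4`. -/
theorem stmt10 {F : Type*} [Field F] [Fintype F] (q : ℕ) (hq : Fintype.card F = q)
    (heven : Even q) (h16 : 16 ≤ q) (k : ℕ) (K : Set (P2 F))
    (hcard : K.ncard = k) (hgen : IsGenArc K) :
    (k : ℝ) ≤ (q : ℝ) - Real.sqrt q / 2 + 17 / 4 := by
  have : CharP F 2 := by
    have h0 : (2 : ℕ) ∣ Fintype.card F := by rw [hq]; exact heven.two_dvd
    obtain ⟨p, hp⟩ := CharP.exists F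
    obtain ⟨n, hpp, hn⟩ := FiniteField.card F p
    rw [hn] at h0
    have h2 := (Nat.prime_dvd_prime_iff_eq Nat.prime_two hpp).mp
      (Nat.prime_two.dvd_of_dvd_pow h0)
    rwa [h2]
  obtain ⟨T, hT, hTk⟩ := hgen.exists_isVecGenArc
  rw [hcard] at hTk
  by_contra! hlt
  have hsq : Real.sqrt q * Real.sqrt q = q := Real.mul_self_sqrt (Nat.cast_nonneg q)
  have hq16 : (16 : ℝ) ≤ q := by exact_mod_cast h16
  have hs4 : 4 ≤ Real.sqrt q := Real.le_sqrt_of_sq_le (by linarith)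
  have hkT : (k : ℝ) ≤ T.card + 3 := by exact_mod_cast hTk
  have hT3 : 3 ≤ T.card := by
    have : (3 : ℝ) ≤ T.card := by nlinarith
    exact_mod_cast this
  obtain ⟨t, ht⟩ := Nat.exists_eq_add_of_le (hT.card_le_card_add_two hT3)
  have h1 := hT.card_lt_sq ht.symm (by rwa [hq])
  rw [hq] at h1 ht
  have h1' : (q : ℝ) < (t + 1) * (t + 1) := by exact_mod_cast h1
  have ht' : (q : ℝ) + 2 = T.card + t := by exact_mod_cast ht
  have h2 : (t : ℝ) + 1 ≤ Real.sqrt q := by linarith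
  have h3 : (0 : ℝ) ≤ t := Nat.cast_nonneg t
  nlinarith
end

section
/- Let F be a finite field with q elements where q ≥ 7 is odd, and let m ≥ 6 be an integer such that every arc in P²(F) with more than m points is contained in the point set of some conic. Then every generalized k-arc in P²(F) satisfies k ≤ m + 3. (In particular, taking m = m′(2,q), the size of the second largest complete arc, one gets m_g(2,q) ≤ m′(2,q) + 3.) -/
/-- The union of two lines is a (reducible) conic. -/
theorem IsLine.union_isConic {F : Type*} [Field F] {L M : Set (P2 F)} (hL : IsLine L)
    (hM : IsLine M) : IsConic (L ∪ M) := by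
  obtain ⟨φ, hφ, hφ', rfl⟩ := hL
  obtain ⟨ψ, hψ, hψ', rfl⟩ := hM
  refine ⟨φ * ψ, mul_ne_zero hφ hψ, hφ'.mul hψ', ?_⟩
  ext p
  simp

/-- Any two points of the projective plane lie on a line. -/
theorem exists_isLine_mem_mem {F : Type*} [Field F] (p r : P2 F) :
    ∃ L : Set (P2 F), IsLine L ∧ p ∈ L ∧ r ∈ L := by
  obtain ⟨c, hc, hc0⟩ := (Submodule.ne_bot_iff _).1 <|
    LinearMap.ker_ne_bot_of_finrank_lt (f := Matrix.mulVecLin !![p.rep 0, p.rep 1, p.rep 2;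
      r.rep 0, r.rep 1, r.rep 2]) (by simp)
  rw [LinearMap.mem_ker, Matrix.mulVecLin_apply] at hc
  refine ⟨_, ⟨∑ i, MvPolynomial.C (c i) * MvPolynomial.X i, fun h => hc0 ?_, ?_, rfl⟩, ?_, ?_⟩
  · ext j
    have := congrArg (MvPolynomial.eval (Pi.single j 1)) h
    simpa [Pi.single_apply] using this
  · exact MvPolynomial.IsHomogeneous.sum _ _ _ fun i _ =>
      MvPolynomial.isHomogeneous_C_mul_X _ _
  · have := congrFun hc 0
    simpa [Matrix.mulVec, dotProduct, Fin.sum_univ_three, mul_comm] using this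
  · have := congrFun hc 1
    simpa [Matrix.mulVec, dotProduct, Fin.sum_univ_three, mul_comm] using this

/-- The points of a generalized arc on a line `L`, together with the points off `L` on another
line, number at most five. -/
theorem IsGenArc.ncard_inter_add_ncard_sdiff_inter_le {F : Type*} [Field F] [Finite F]
    {K L M : Set (P2 F)} (hK : IsGenArc K) (hL : IsLine L) (hM : IsLine M) :
    (K ∩ L).ncard + ((K \ L) ∩ M).ncard ≤ 5 := by
  have : Finite (P2 F) := Quotient.finite _
  rw [← Set.ncard_union_eq (Set.disjoint_left.2 fun x hx hx' => hx'.1.2 hx.2)]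
  refine (Set.ncard_le_ncard ?_).trans (hK _ (hL.union_isConic hM))
  rintro x (⟨hx, hxL⟩ | ⟨⟨hx, -⟩, hxM⟩)
  exacts [⟨hx, Or.inl hxL⟩, ⟨hx, Or.inr hxM⟩]

/-- A line contains at most three points of a generalized arc with at least seven points. -/
theorem IsGenArc.ncard_inter_isLine_le {F : Type*} [Field F] [Finite F]
    {K L : Set (P2 F)} (hK : IsGenArc K) (hcard : 7 ≤ K.ncard) (hL : IsLine L) :
    (K ∩ L).ncard ≤ 3 := by
  have : Finite (P2 F) := Quotient.finite _
  have h_split := Set.ncard_inter_add_ncard_sdiff_eq_ncard K L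
  have h_five := hK.ncard_inter_add_ncard_sdiff_inter_le hL hL
  obtain ⟨p, hp, r, hr, hpr⟩ := (Set.one_lt_ncard).1 (show 1 < (K \ L).ncard by omega)
  obtain ⟨M, hM, hpM, hrM⟩ := exists_isLine_mem_mem p r
  have h_two : 2 ≤ ((K \ L) ∩ M).ncard := by
    rw [← Set.ncard_pair hpr]
    exact Set.ncard_le_ncard (Set.insert_subset ⟨hp, hpM⟩ (Set.singleton_subset_iff.2 ⟨hr, hrM⟩))
  have := hK.ncard_inter_add_ncard_sdiff_inter_le hL hM
  omega

/-- for `q ≥ 7` odd, if every arc with more than `m ≥ 6` points is contained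
in the point set of some conic, then every generalized `k`-arc satisfies `k ≤ m + 3`. -/
theorem stmt11 {F : Type*} [Field F] [Fintype F] (q : ℕ) (hq : Fintype.card F = q)
    (hodd : Odd q) (h7 : 7 ≤ q) (m : ℕ) (hm : 6 ≤ m)
    (hcont : ∀ K : Set (P2 F), IsArc K → m < K.ncard →
      ∃ C : Set (P2 F), IsConic C ∧ K ⊆ C)
    (k : ℕ) (K : Set (P2 F)) (hcard : K.ncard = k) (hgen : IsGenArc K) :
    k ≤ m + 3 := by
  have : Finite (P2 F) := Quotient.finite _
  by_contra! hlt
  have not_arc : ∀ A ⊆ K, m < A.ncard → ¬ IsArc A := fun A hAK hA hA_arc => by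
    obtain ⟨C, hC, hAC⟩ := hcont A hA_arc hA
    have := Set.ncard_le_ncard (Set.subset_inter hAK hAC)
    have := hgen C hC
    omega
  have h_not := not_arc K subset_rfl (by omega)
  simp only [IsArc, not_forall, not_le] at h_not
  obtain ⟨L, hL, hL_card⟩ := h_not
  have h_three := hgen.ncard_inter_isLine_le (by omega) hL
  have h_split := Set.ncard_inter_add_ncard_sdiff_eq_ncard K L
  refine not_arc (K \ L) Set.sdiff_subset (by omega) fun M hM => ?_
  have := hgen.ncard_inter_add_ncard_sdiff_inter_le hL hM
  omega
end
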